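/- arXiv:2111.00737 — 4 statements merged into one kernel-verified Lean document; each statement's English description precedes it below -/
import Mathlib

section
/- Let G be a group and R, S, T normal subgroups of G. Then the subgroup [[R,S,T]] is contained in G ∩ (1 + ((𝐫,𝐬,𝐭))), the latter is a normal subgroup of G, and the quotient group (G ∩ (1 + ((𝐫,𝐬,𝐭)))) / [[R,S,T]] is an abelian group in which every element has order a power of 2. -/
/-!
STATEMENT 0. For a group `G` with normal subgroups `R, S, T`:
the subgroup `[[R,S,T]] = [R∩S,T][S∩T,R][T∩R,S]` is contained in
`D = G ∩ (1 + ((𝐫,𝐬,𝐭)))`, `D` is a normal subgroup of `G`, and the quotient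
`D/[[R,S,T]]` is an abelian group all of whose elements have order a power of 2
(i.e. commutators of elements of `D` lie in `[[R,S,T]]`, and every `g ∈ D` has
`g^(2^k) ∈ [[R,S,T]]` for some `k`).
-/

/-- The two-sided ideal `(N-1)ℤ[G]` of `ℤ[G]` generated by `{n - 1 : n ∈ N}`,
viewed as a `ℤ`-submodule (products of such submodules are additive spans of
products, matching the usual product of two-sided ideals). -/
noncomputable def relativeIdeal {G : Type*} [Group G] (N : Subgroup G) :
    Submodule ℤ (MonoidAlgebra ℤ G) :=
  Submodule.span ℤ {x | ∃ (a b : MonoidAlgebra ℤ G) (r : G), r ∈ N ∧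
    x = a * (MonoidAlgebra.of ℤ G r - 1) * b}

/-- The ideal `((𝐫,𝐬,𝐭)) = 𝐫(𝐬∩𝐭) + (𝐬∩𝐭)𝐫 + 𝐬(𝐭∩𝐫) + (𝐭∩𝐫)𝐬 + 𝐭(𝐫∩𝐬) + (𝐫∩𝐬)𝐭`. -/
noncomputable def tripleIdeal {G : Type*} [Group G] (R S T : Subgroup G) :
    Submodule ℤ (MonoidAlgebra ℤ G) :=
  relativeIdeal R * (relativeIdeal S ⊓ relativeIdeal T) +
    (relativeIdeal S ⊓ relativeIdeal T) * relativeIdeal R +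
  relativeIdeal S * (relativeIdeal T ⊓ relativeIdeal R) +
    (relativeIdeal T ⊓ relativeIdeal R) * relativeIdeal S +
  relativeIdeal T * (relativeIdeal R ⊓ relativeIdeal S) +
    (relativeIdeal R ⊓ relativeIdeal S) * relativeIdeal T

/-- `[[R,S,T]] = [R∩S,T]·[S∩T,R]·[T∩R,S]`; as all factors are normal subgroups,
the product subgroup is their join. -/
def tripleCommutator {G : Type*} [Group G] (R S T : Subgroup G) : Subgroup G :=
  ⁅R ⊓ S, T⁆ ⊔ ⁅S ⊓ T, R⁆ ⊔ ⁅T ⊓ R, S⁆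

/-- The commutator `[g,h] = g⁻¹h⁻¹gh` of group elements. -/
def cmt {G : Type*} [Group G] (x y : G) : G := x⁻¹ * y⁻¹ * x * y

/-! ### Strict braidings and their realizations -/

universe u

/-- A strictly antisymmetric braiding on a crossed module `d : W → V`, the action of `x : V` on
`w : W` being `κ x (d w) * w`. -/
structure StrictBraiding {V W : Type u} [Group V] [Group W] (d : W →* V) (κ : V → V → W) :
    Prop where
  map_mul_left : ∀ x y z, κ (x * y) z = κ x (d (κ y z)) * κ y z * κ x z
  map_mul_right : ∀ x y z, κ x (y * z) = κ x y * (κ y (d (κ x z)) * κ x z)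
  self : ∀ x, κ x x = 1
  swap : ∀ x y, κ x y * κ y x = 1
  boundary : ∀ x y, d (κ x y) = x * y * x⁻¹ * y⁻¹
  peiffer : ∀ w w', κ (d w) (d w') = w * w' * w⁻¹ * w'⁻¹

/-- A group over `V` containing `W` in which commutators are given by `κ`. -/
structure Realization {V W : Type u} [Group V] [Group W] (d : W →* V) (κ : V → V → W) where
  carrier : Type u
  [group : Group carrier]
  proj : carrier →* V
  incl : W →* carrier
  proj_incl : ∀ w, proj (incl w) = d w
  incl_injective : Function.Injective incl
  mul_comm' : ∀ x y, x * y = incl (κ (proj x) (proj y)) * y * x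

attribute [instance] Realization.group

namespace StrictBraiding

variable {V W : Type u} [Group V] [Group W] {d : W →* V} {κ : V → V → W}

theorem one_left (h : StrictBraiding d κ) (z : V) : κ 1 z = 1 := by
  have h1 := h.map_mul_left 1 1 z
  have h2 := h.boundary 1 z
  simp only [one_mul, inv_one, mul_one, mul_inv_cancel] at h2
  have h3 : κ 1 1 = 1 := h.self 1
  rw [one_mul, h2, h3, one_mul] at h1
  exact (left_eq_mul.mp h1)

theorem one_right (h : StrictBraiding d κ) (z : V) : κ z 1 = 1 := by
  have := h.swap z 1
  rwa [h.one_left, mul_one] at this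

theorem act_mul (h : StrictBraiding d κ) (x y : V) (w : W) :
    κ (x * y) (d w) * w = κ x (d (κ y (d w) * w)) * (κ y (d w) * w) := by
  rw [h.map_mul_left, map_mul, h.map_mul_right, h.peiffer]
  group

theorem inv_conj (h : StrictBraiding d κ) (l y : V) :
    κ l⁻¹ (l * y * l⁻¹) * κ l y = 1 := by
  have e : l * y * l⁻¹ = d (κ l y) * y := by rw [h.boundary]; group
  have h1 := h.map_mul_left l⁻¹ l y
  rw [inv_mul_cancel, h.one_left] at h1
  rw [e, h.map_mul_right, h.peiffer]
  calc _ = κ l⁻¹ (d (κ l y)) * κ l y * κ l⁻¹ y := by group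
    _ = 1 := h1.symm

end StrictBraiding

namespace Realization

variable {V W : Type u} [Group V] [Group W] {d : W →* V} {κ : V → V → W}

theorem mul_incl (C : Realization d κ) (x : C.carrier) (w : W) :
    x * C.incl w = C.incl (κ (C.proj x) (d w) * w) * x := by
  rw [C.mul_comm', C.proj_incl, map_mul]

/-- To check the commutator formula it suffices to do so on generators. -/
theorem commutator_of_closure {C : Type u} [Group C] (h : StrictBraiding d κ) (p : C →* V)
    (i : W →* C) (X : Set C) (hX : Subgroup.closure X = ⊤)
    (hconj : ∀ x ∈ X, ∀ w, x * i w = i (κ (p x) (d w) * w) * x)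
    (hcomm : ∀ x ∈ X, ∀ y ∈ X, x * y = i (κ (p x) (p y)) * y * x) (x y : C) :
    x * y = i (κ (p x) (p y)) * y * x := by
  have conj : ∀ x w, x * i w = i (κ (p x) (d w) * w) * x := by
    intro x
    have hx : x ∈ Subgroup.closure X := hX ▸ Subgroup.mem_top x
    induction hx using Subgroup.closure_induction with
    | mem x hx => exact hconj x hx
    | one => intro w; simp [h.one_left]
    | mul x y _ _ hx hy =>
      intro w
      rw [mul_assoc, hy, ← mul_assoc, hx, mul_assoc, map_mul p, h.act_mul]
    | inv x _ hx =>
      intro w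
      have := hx (κ (p x⁻¹) (d w) * w)
      rw [← h.act_mul, ← map_mul p, mul_inv_cancel, map_one, h.one_left, one_mul] at this
      rw [inv_mul_eq_iff_eq_mul, ← mul_assoc, this, mul_inv_cancel_right]
  have mulL : ∀ x y z, x * z = i (κ (p x) (p z)) * z * x → y * z = i (κ (p y) (p z)) * z * y →
      (x * y) * z = i (κ (p (x * y)) (p z)) * z * (x * y) := by
    intro x y z hx hy
    rw [mul_assoc, hy, map_mul p, h.map_mul_left, map_mul i, ← mul_assoc, ← mul_assoc, conj,
      mul_assoc _ x z, hx]
    group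
  have invL : ∀ x z, x * z = i (κ (p x) (p z)) * z * x →
      x⁻¹ * z = i (κ (p x⁻¹) (p z)) * z * x⁻¹ := by
    intro x z hx
    have h1 := h.map_mul_left (p x⁻¹) (p x) (p z)
    rw [← map_mul, inv_mul_cancel, map_one, h.one_left] at h1
    have h2 := conj x⁻¹ (κ (p x) (p z))
    have h3 : i (κ (p x⁻¹) (p z)) = (i (κ (p x⁻¹) (d (κ (p x) (p z))) * κ (p x) (p z)))⁻¹ := by
      rw [← map_inv, ← inv_eq_of_mul_eq_one_right h1.symm]
    rw [h3]
    have h4 : z * x⁻¹ = x⁻¹ * i (κ (p x) (p z)) * z := by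
      rw [mul_inv_eq_iff_eq_mul, mul_assoc, mul_assoc, ← mul_assoc (i _), ← hx]
      group
    rw [mul_assoc, h4, h2]
    group
  have symm : ∀ x z, x * z = i (κ (p x) (p z)) * z * x → z * x = i (κ (p z) (p x)) * x * z := by
    intro x z hx
    rw [mul_assoc, hx, ← mul_assoc, ← mul_assoc, ← map_mul, h.swap, map_one, one_mul]
  have half : ∀ y ∈ X, ∀ x, x * y = i (κ (p x) (p y)) * y * x := by
    intro y hy x
    have hx : x ∈ Subgroup.closure X := hX ▸ Subgroup.mem_top x
    induction hx using Subgroup.closure_induction with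
    | mem x hx => exact hcomm x hx y hy
    | one => simp [h.one_left]
    | mul x x' _ _ hx hx' => exact mulL _ _ _ hx hx'
    | inv x _ hx => exact invL _ _ hx
  have hx : x ∈ Subgroup.closure X := hX ▸ Subgroup.mem_top x
  induction hx using Subgroup.closure_induction with
  | mem x hx => exact symm _ _ (half x hx y)
  | one => simp [h.one_left]
  | mul x x' _ _ hx hx' => exact mulL _ _ _ hx hx'
  | inv x _ hx => exact invL _ _ hx

/-- `W` realizes its own braiding. -/
def self (h : StrictBraiding d κ) : Realization d κ where
  carrier := W
  proj := d
  incl := MonoidHom.id W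
  proj_incl _ := rfl
  incl_injective _ _ h := h
  mul_comm' x y := by simp [h.peiffer]

/-- The automorphism of a realization by which a new element lying over `l` acts. -/
def twist (h : StrictBraiding d κ) (C : Realization d κ) (l : V) : MulAut C.carrier where
  toFun x := C.incl (κ l (C.proj x)) * x
  invFun x := C.incl (κ l⁻¹ (C.proj x)) * x
  left_inv x := by
    have : C.proj (C.incl (κ l (C.proj x)) * x) = l * C.proj x * l⁻¹ := by
      rw [map_mul, C.proj_incl, h.boundary]; group
    simp only [this]
    rw [← mul_assoc, ← map_mul, h.inv_conj, map_one, one_mul]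
  right_inv x := by
    have : C.proj (C.incl (κ l⁻¹ (C.proj x)) * x) = l⁻¹ * C.proj x * l⁻¹⁻¹ := by
      rw [map_mul, C.proj_incl, h.boundary]; group
    simp only [this]
    have e := h.inv_conj l⁻¹ (C.proj x)
    rw [inv_inv] at e ⊢
    rw [← mul_assoc, ← map_mul, e, map_one, one_mul]
  map_mul' x y := by
    have := C.mul_incl x (κ l (C.proj y))
    simp only [map_mul] at this ⊢
    rw [h.map_mul_right, map_mul, map_mul, mul_assoc (C.incl _) x, ← mul_assoc x, this]
    group

theorem twist_apply (h : StrictBraiding d κ) (C : Realization d κ) (l : V) (x : C.carrier) :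
    C.twist h l x = C.incl (κ l (C.proj x)) * x := rfl

theorem exists_extend (h : StrictBraiding d κ) (C : Realization d κ) (l : V) :
    ∃ C' : Realization d κ, (∀ v ∈ C.proj.range, v ∈ C'.proj.range) ∧ l ∈ C'.proj.range := by
  let φ : Multiplicative ℤ →* MulAut C.carrier := zpowersHom _ (C.twist h l)
  let t : C.carrier ⋊[φ] Multiplicative ℤ := SemidirectProduct.inr (Multiplicative.ofAdd 1)
  have hφ : ∀ n, C.proj.comp (φ n).toMonoidHom =
      (MulAut.conj (zpowersHom V l n)).toMonoidHom.comp C.proj := by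
    intro n
    have gen : ∀ x, C.proj (C.twist h l x) = l * C.proj x * l⁻¹ := fun x => by
      rw [twist_apply, map_mul, C.proj_incl, h.boundary]; group
    have gen' : ∀ x, C.proj ((C.twist h l)⁻¹ x) = l⁻¹ * C.proj x * l := fun x => by
      have := gen ((C.twist h l)⁻¹ x)
      rw [MulAut.apply_inv_self] at this
      rw [this]; group
    have key : ∀ (n : ℤ) x, C.proj ((C.twist h l ^ n) x) = l ^ n * C.proj x * (l ^ n)⁻¹ := by
      intro n
      induction n using Int.induction_on with
      | zero => simp
      | succ n ih => intro x; rw [zpow_add_one, MulAut.mul_apply, ih, gen]; group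
      | pred n ih => intro x; rw [zpow_sub_one, MulAut.mul_apply, ih, gen']; group
    ext x
    exact key n.toAdd x
  let p : C.carrier ⋊[φ] Multiplicative ℤ →* V :=
    SemidirectProduct.lift C.proj (zpowersHom V l) hφ
  let i : W →* C.carrier ⋊[φ] Multiplicative ℤ := SemidirectProduct.inl.comp C.incl
  have pt : p t = l := by simp [p, t]
  have pl : ∀ c, p (SemidirectProduct.inl c) = C.proj c := fun c => by simp [p]
  have tl : ∀ c, t * SemidirectProduct.inl c =
      SemidirectProduct.inl (C.incl (κ l (C.proj c))) * SemidirectProduct.inl c * t := by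
    intro c
    rw [← map_mul, ← twist_apply h]
    have := SemidirectProduct.inl_aut (φ := φ) (Multiplicative.ofAdd 1) c
    have e : φ (Multiplicative.ofAdd 1) = C.twist h l := by simp [φ]
    rw [e] at this
    rw [this]
    simp [t, mul_assoc]
  let X : Set (C.carrier ⋊[φ] Multiplicative ℤ) := Set.range SemidirectProduct.inl ∪ {t}
  have hX : Subgroup.closure X = ⊤ := by
    rw [eq_top_iff]
    intro x _
    rw [← SemidirectProduct.inl_left_mul_inr_right x]
    refine mul_mem (Subgroup.subset_closure (Or.inl ⟨_, rfl⟩)) ?_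
    have : (SemidirectProduct.inr x.right : C.carrier ⋊[φ] Multiplicative ℤ) =
        t ^ x.right.toAdd := by
      refine Eq.trans ?_ (map_zpow (SemidirectProduct.inr : Multiplicative ℤ →*
        C.carrier ⋊[φ] Multiplicative ℤ) (Multiplicative.ofAdd 1) x.right.toAdd)
      rw [← ofAdd_zsmul]
      simp
    rw [this]
    exact Subgroup.zpow_mem _ (Subgroup.subset_closure (k := X) (Or.inr (Set.mem_singleton t))) _
  have comm := commutator_of_closure h p i X hX
    (by
      rintro x (⟨c, rfl⟩ | rfl) w
      · rw [pl]
        simp only [i, MonoidHom.comp_apply]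
        rw [← map_mul, C.mul_incl, map_mul]
      · rw [pt]
        simp only [i, MonoidHom.comp_apply]
        rw [tl, C.proj_incl, map_mul, map_mul])
    (by
      rintro x (⟨c, rfl⟩ | rfl) y (⟨c', rfl⟩ | rfl)
      · rw [pl, pl, ← map_mul, C.mul_comm']
        simp [i]
      · have e : i (κ (p t) (C.proj c)) = SemidirectProduct.inl (C.incl (κ l (C.proj c))) := by
          rw [pt]; rfl
        rw [pl, mul_assoc, tl, ← e, ← mul_assoc, ← mul_assoc, ← map_mul, h.swap, map_one, one_mul]
      · rw [pl, pt]
        exact tl c'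
      · rw [h.self, map_one, one_mul])
  refine ⟨⟨C.carrier ⋊[φ] Multiplicative ℤ, p, i, fun w => ?_, ?_, comm⟩, ?_, ⟨t, pt⟩⟩
  · simp only [i, MonoidHom.comp_apply]
    rw [pl, C.proj_incl]
  · exact SemidirectProduct.inl_injective.comp C.incl_injective
  · rintro _ ⟨c, rfl⟩
    exact ⟨_, pl c⟩

theorem exists_of_finset (h : StrictBraiding d κ) (I : Finset V) :
    ∃ C : Realization d κ, ∀ v ∈ I, v ∈ C.proj.range := by
  classical
  induction I using Finset.induction_on with
  | empty => exact ⟨self h, by simp⟩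
  | insert l I _ ih =>
    obtain ⟨C, hC⟩ := ih
    obtain ⟨C', h1, h2⟩ := exists_extend h C l
    refine ⟨C', fun v hv => ?_⟩
    rcases Finset.mem_insert.1 hv with rfl | hv
    · exact h2
    · exact h1 v (hC v hv)

/-- Every strict braiding has a realization lying over all of `V`: a reduced product of
realizations lying over finite subsets. -/
theorem exists_surjective (h : StrictBraiding d κ) :
    ∃ C : Realization d κ, Function.Surjective C.proj := by
  classical
  choose C hC using exists_of_finset h
  let D : Subgroup ((∀ I, (C I).carrier) × V) :=
    { carrier := {x | ∀ᶠ I in Filter.atTop, (C I).proj (x.1 I) = x.2}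
      one_mem' := by simp
      mul_mem' := by
        intro x y hx hy
        filter_upwards [hx, hy] with I h1 h2
        simp [h1, h2]
      inv_mem' := by
        intro x hx
        filter_upwards [hx] with I h1
        simp [h1] }
  let N : Subgroup D :=
    { carrier := {x | x.1.2 = 1 ∧ ∀ᶠ I in Filter.atTop, x.1.1 I = 1}
      one_mem' := by simp
      mul_mem' := by
        rintro x y ⟨hx, hx'⟩ ⟨hy, hy'⟩
        refine ⟨by simp [hx, hy], ?_⟩
        filter_upwards [hx', hy'] with I h1 h2
        simp [h1, h2]
      inv_mem' := by
        rintro x ⟨hx, hx'⟩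
        refine ⟨by simp [hx], ?_⟩
        filter_upwards [hx'] with I h1
        simp [h1] }
  have : N.Normal := ⟨by
    rintro x ⟨hx, hx'⟩ g
    refine ⟨by simp [hx], ?_⟩
    filter_upwards [hx'] with I h1
    simp [h1]⟩
  let P : D →* V := (MonoidHom.snd _ _).comp D.subtype
  let i : W →* D :=
    { toFun := fun w => ⟨(fun I => (C I).incl w, d w),
        Filter.Eventually.of_forall fun I => (C I).proj_incl w⟩
      map_one' := by ext <;> simp
      map_mul' := fun w w' => by ext <;> simp }
  let p : D ⧸ N →* V := QuotientGroup.lift N P fun x hx => hx.1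
  refine ⟨⟨D ⧸ N, p, (QuotientGroup.mk' N).comp i, fun w => rfl, ?_, ?_⟩, ?_⟩
  · rw [injective_iff_map_eq_one]
    intro w hw
    have hw' : i w ∈ N := (QuotientGroup.eq_one_iff _).1 hw
    obtain ⟨I, hI⟩ := hw'.2.exists
    exact (C I).incl_injective (hI.trans (map_one _).symm)
  · intro x y
    induction x using QuotientGroup.induction_on with | _ x
    induction y using QuotientGroup.induction_on with | _ y
    have : ((x * y : D) : D ⧸ N) = ((i (κ x.1.2 y.1.2) * y * x : D) : D ⧸ N) := by
      rw [QuotientGroup.eq]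
      refine ⟨?_, ?_⟩
      · have := h.boundary x.1.2 y.1.2
        simp only [i, Subgroup.coe_mul, Subgroup.coe_inv, Prod.snd_mul, Prod.snd_inv,
          MonoidHom.coe_mk, OneHom.coe_mk, this]
        group
      · filter_upwards [x.2, y.2] with I h1 h2
        have := (C I).mul_comm' (x.1.1 I) (y.1.1 I)
        rw [h1, h2] at this
        simp only [i, Subgroup.coe_mul, Subgroup.coe_inv, Prod.fst_mul, Prod.fst_inv,
          MonoidHom.coe_mk, OneHom.coe_mk, Pi.mul_apply, Pi.inv_apply, ← this]
        group
    exact this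
  · intro v
    have : ∀ I : Finset V, ∃ c : (C I).carrier, v ∈ I → (C I).proj c = v := by
      intro I
      by_cases hv : v ∈ I
      · obtain ⟨c, hc⟩ := hC I v hv
        exact ⟨c, fun _ => hc⟩
      · exact ⟨1, fun h => absurd h hv⟩
    choose c hc using this
    refine ⟨QuotientGroup.mk (⟨(c, v), ?_⟩ : D), rfl⟩
    filter_upwards [Filter.eventually_ge_atTop ({v} : Finset V)] with I hI
    exact hc I (hI (Finset.mem_singleton_self v))

end Realization

/-! ### The divisible group `ℚ / ℤ[1/2]` -/

/-- The dyadic rationals, as a subgroup of `ℚ`. -/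
def dyadicRationals : AddSubgroup ℚ where
  carrier := {x | ∃ (k : ℕ) (m : ℤ), 2 ^ k * x = m}
  zero_mem' := ⟨0, 0, by simp⟩
  add_mem' := by
    rintro x y ⟨k, m, hx⟩ ⟨l, n, hy⟩
    refine ⟨k + l, 2 ^ l * m + 2 ^ k * n, ?_⟩
    push_cast
    rw [← hx, ← hy]
    ring
  neg_mem' := by
    rintro x ⟨k, m, hx⟩
    exact ⟨k, -m, by push_cast; rw [← hx]; ring⟩

/-- The group `ℚ / ℤ[1/2]`. -/
abbrev DyadicQuotient : Type := ℚ ⧸ dyadicRationals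

namespace DyadicQuotient

theorem exists_extend {A : Type*} {A' : Type*} [AddCommGroup A] [AddCommGroup A'] (i : A' →+ A)
    (hi : Function.Injective i) (φ : A' →+ DyadicQuotient) :
    ∃ ψ : A →+ DyadicQuotient, ∀ a, ψ (i a) = φ a := by
  have hB : Module.Baer ℤ DyadicQuotient := by
    let _ : DivisibleBy ℚ ℕ := AddGroup.divisibleByNatOfDivisibleByInt ℚ
    let _ : DivisibleBy DyadicQuotient ℕ := QuotientAddGroup.divisibleBy dyadicRationals
    let _ : DivisibleBy DyadicQuotient ℤ := AddGroup.divisibleByIntOfDivisibleByNat _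
    exact Module.Baer.of_divisible _
  obtain ⟨ψ, hψ⟩ := hB.extension_property_addMonoidHom i hi φ
  exact ⟨ψ, fun a => DFunLike.congr_fun hψ a⟩

theorem exists_half : ∃ half : DyadicQuotient →+ DyadicQuotient, ∀ x, half x + half x = x := by
  refine ⟨QuotientAddGroup.map _ _ (AddMonoidHom.mulLeft (1 / 2 : ℚ)) ?_, fun x => ?_⟩
  · rintro x ⟨k, m, hx⟩
    refine ⟨k + 1, m, ?_⟩
    simp only [AddMonoidHom.coe_mulLeft]
    rw [← hx]
    ring
  · induction x using QuotientAddGroup.induction_on with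
    | H x =>
      rw [QuotientAddGroup.map_mk, ← QuotientAddGroup.mk_add]
      congr 1
      simp only [AddMonoidHom.coe_mulLeft]
      ring

/-- Elements whose order is not a power of two are detected by characters. -/
theorem exists_character {A : Type*} [AddCommGroup A] (a : A) (ha : ∀ k : ℕ, 2 ^ k • a ≠ 0) :
    ∃ φ : A →+ DyadicQuotient, φ a ≠ 0 := by
  have key : ∃ m : ℕ, Odd m ∧ 1 < m ∧ m ∣ addOrderOf a := by
    rcases Nat.eq_two_pow_or_exists_odd_prime_and_dvd (addOrderOf a) with ⟨k, hk⟩ | ⟨p, hp, hd, ho⟩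
    · exact absurd (by rw [← hk]; exact addOrderOf_nsmul_eq_zero a) (ha k)
    · exact ⟨p, ho, hp.one_lt, hd⟩
  obtain ⟨m, hm, hm1, hmd⟩ := key
  let b : DyadicQuotient := QuotientAddGroup.mk (1 / m : ℚ)
  have hm0 : (m : ℚ) ≠ 0 := by exact_mod_cast (by omega)
  have hb : b ≠ 0 := by
    intro h
    rw [QuotientAddGroup.eq_zero_iff] at h
    obtain ⟨k, n, h⟩ := h
    have h2 : (2 ^ k : ℤ) = n * m := by
      have : (2 ^ k : ℚ) = n * m := by rw [← h]; field_simp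
      exact_mod_cast this
    have h3 : (m : ℤ) ∣ 2 ^ k := ⟨n, by rw [h2]; ring⟩
    have h4 : m ∣ 2 ^ k := by exact_mod_cast h3
    have h5 : Nat.Coprime m (2 ^ k) := Nat.Coprime.pow_right _ (Nat.coprime_two_right.mpr hm)
    have := Nat.eq_one_of_dvd_coprimes h5 dvd_rfl h4
    omega
  have hmb : m • b = 0 := by
    rw [← QuotientAddGroup.mk_nsmul, QuotientAddGroup.eq_zero_iff]
    exact ⟨0, 1, by simp; field_simp⟩
  let g : ℤ →+ DyadicQuotient := zmultiplesHom _ b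
  let e : ℤ →+ A := zmultiplesHom _ a
  have hker : e.ker ≤ g.ker := by
    intro n hn
    have hn' : n • a = 0 := hn
    rw [← addOrderOf_dvd_iff_zsmul_eq_zero] at hn'
    obtain ⟨q, hq⟩ := (Int.natCast_dvd_natCast.mpr hmd).trans hn'
    show n • b = 0
    rw [hq, mul_comm, mul_smul, natCast_zsmul, hmb, smul_zero]
  obtain ⟨ψ, hψ⟩ := exists_extend (QuotientAddGroup.kerLift e)
    (QuotientAddGroup.kerLift_injective e)
    (QuotientAddGroup.lift e.ker g hker)
  refine ⟨ψ, ?_⟩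
  have := hψ (QuotientAddGroup.mk 1)
  rw [QuotientAddGroup.kerLift_mk, QuotientAddGroup.lift_mk] at this
  have h1 : e 1 = a := by simp [e]
  have h2 : g 1 = b := by simp [g]
  rw [h1, h2] at this
  rwa [this]

end DyadicQuotient

/-! ### Strictifying a braiding after a central extension -/

/-- A braided crossed module `d : W → V`, the action of `x : V` on `w : W` being
`κ x (d w) * w`. -/
structure Braiding {V W : Type u} [Group V] [Group W] (d : W →* V) (κ : V → V → W) : Prop where
  map_mul_left : ∀ x y z, κ (x * y) z = κ x (d (κ y z)) * κ y z * κ x z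
  map_mul_right : ∀ x y z, κ x (y * z) = κ x y * (κ y (d (κ x z)) * κ x z)
  boundary : ∀ x y, d (κ x y) = x * y * x⁻¹ * y⁻¹
  peiffer : ∀ w w', κ (d w) (d w') = w * w' * w⁻¹ * w'⁻¹
  swap_boundary : ∀ x w, κ x (d w) * κ (d w) x = 1

namespace Braiding

variable {V W : Type u} [Group V] [Group W] {d : W →* V} {κ : V → V → W}

theorem one_right (h : Braiding d κ) (x : V) : κ x 1 = 1 := by
  have h0 : κ 1 1 = 1 := by
    have := h.peiffer 1 1
    simpa using this
  have h1 : d (κ x 1) = 1 := by rw [h.boundary]; group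
  have h2 := h.map_mul_right x 1 1
  rw [h1, h0, one_mul, one_mul] at h2
  exact left_eq_mul.mp h2

theorem one_left (h : Braiding d κ) (x : V) : κ 1 x = 1 := by
  have := h.swap_boundary x 1
  rwa [map_one, h.one_right, one_mul] at this

theorem act_mul (h : Braiding d κ) (x : V) (w w' : W) :
    κ x (d (w * w')) * (w * w') = (κ x (d w) * w) * (κ x (d w') * w') := by
  rw [map_mul, h.map_mul_right, h.peiffer]
  group

theorem commute_of_mem_ker (h : Braiding d κ) {k : W} (hk : d k = 1) (w : W) :
    k * w = w * k := by
  have := h.peiffer k w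
  rw [hk, h.one_left] at this
  calc k * w = (k * w * k⁻¹ * w⁻¹) * (w * k) := by group
    _ = w * k := by rw [← this, one_mul]

theorem boundary_sym (h : Braiding d κ) (x y : V) : d (κ x y * κ y x) = 1 := by
  rw [map_mul, h.boundary, h.boundary]
  group

theorem sym_comm (h : Braiding d κ) (x y : V) : κ y x * κ x y = κ x y * κ y x := by
  have := h.commute_of_mem_ker (h.boundary_sym y x) (κ y x)⁻¹
  calc κ y x * κ x y = (κ y x * κ x y) * (κ y x)⁻¹ * κ y x := by group
    _ = _ := by rw [this]; group

theorem sym_mul (h : Braiding d κ) (x y z : V) :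
    κ (x * y) z * κ z (x * y) = (κ x z * κ z x) * (κ y z * κ z y) := by
  rw [h.map_mul_left, h.map_mul_right]
  have hc := h.commute_of_mem_ker (h.boundary_sym x z)
  have ha := h.act_mul x (κ y z) (κ z y)
  rw [h.boundary_sym, h.one_right, one_mul] at ha
  calc _ = κ x (d (κ y z)) * κ y z * (κ x z * κ z x) * (κ x (d (κ z y)) * κ z y) := by group
    _ = (κ x z * κ z x) * ((κ x (d (κ y z)) * κ y z) * (κ x (d (κ z y)) * κ z y)) := by
      rw [← hc (κ x (d (κ y z)) * κ y z), mul_assoc]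
    _ = _ := by rw [← ha]

/-- Half of the symmetrization of a braiding is a bilinear form with the same quadratic form. -/
theorem exists_bilinear (h : Braiding d κ) (ι : d.ker →* Multiplicative DyadicQuotient) :
    ∃ β : V → V → DyadicQuotient, (∀ x y z, β (x * y) z = β x z + β y z) ∧
      (∀ x y z, β x (y * z) = β x y + β x z) ∧
      (∀ x w, β x (d w) = 0) ∧ (∀ x w, β (d w) x = 0) ∧
      (∀ x (hx : d (κ x x) = 1), Multiplicative.ofAdd (β x x) = ι ⟨κ x x, hx⟩) ∧
      ∀ x y, Multiplicative.ofAdd (β x y + β y x) = ι ⟨κ x y * κ y x, h.boundary_sym x y⟩ := by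
  obtain ⟨half, hh⟩ := DyadicQuotient.exists_half
  let b : V → V → DyadicQuotient := fun x y =>
    Multiplicative.toAdd (ι ⟨κ x y * κ y x, h.boundary_sym x y⟩)
  have b_comm : ∀ x y, b x y = b y x := fun x y => by
    simp only [b]
    congr 3
    exact (h.sym_comm x y).symm
  have b_mul : ∀ x y z, b (x * y) z = b x z + b y z := fun x y z => by
    simp only [b]
    rw [← toAdd_mul, ← map_mul]
    congr 3
    exact h.sym_mul x y z
  have b_d : ∀ x w, b x (d w) = 0 := fun x w => by
    simp only [b]
    rw [← toAdd_one, ← map_one ι]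
    congr 3
    exact h.swap_boundary x w
  refine ⟨fun x y => half (b x y), fun x y z => ?_, fun x y z => ?_, fun x w => ?_, fun x w => ?_,
    fun x hx => ?_, fun x y => ?_⟩
  · simp only [b_mul, map_add]
  · simp only [b_comm x, b_mul, map_add]
  · simp only [b_d, map_zero]
  · simp only [b_comm (d w), b_d, map_zero]
  · have : b x x = Multiplicative.toAdd (ι ⟨κ x x, hx⟩) + Multiplicative.toAdd (ι ⟨κ x x, hx⟩) := by
      rw [← toAdd_mul, ← map_mul]
      rfl
    simp only [this, map_add, hh]
    rfl
  · simp only [b_comm y, hh]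
    rfl

/-- The pushout of `W` along a homomorphism on the central subgroup `ker d`. -/
theorem exists_pushout (h : Braiding d κ) {M : Type} [CommGroup M] (ι : d.ker →* M) :
    ∃ (W₀ : Type u) (_ : Group W₀) (I : W →* W₀) (J : M →* W₀) (d₀ : W₀ →* V),
      (∀ w, d₀ (I w) = d w) ∧ (∀ m, d₀ (J m) = 1) ∧ (∀ k : d.ker, I k = J (ι k)) ∧
      (∀ m x, J m * x = x * J m) ∧ Function.Injective J ∧ ∀ x, ∃ w m, x = I w * J m := by
  have hc : ∀ (k : d.ker) (w : W), (k : W) * w = w * k := fun k w => h.commute_of_mem_ker k.2 w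
  let θ : d.ker →* W × M :=
    { toFun := fun k => (k, (ι k)⁻¹)
      map_one' := by simp
      map_mul' := fun a b => by simp [mul_comm] }
  have hn : θ.range.Normal := by
    constructor
    rintro _ ⟨k, rfl⟩ ⟨w, m⟩
    refine ⟨k, ?_⟩
    ext
    · simp [θ, ← hc k w]
    · simp [θ]
  let I : W →* (W × M) ⧸ θ.range := (QuotientGroup.mk' _).comp (MonoidHom.inl W M)
  let J : M →* (W × M) ⧸ θ.range := (QuotientGroup.mk' _).comp (MonoidHom.inr W M)
  let d₀ : (W × M) ⧸ θ.range →* V := QuotientGroup.lift _ (d.comp (MonoidHom.fst W M)) (by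
    rintro _ ⟨k, rfl⟩
    exact k.2)
  have hIJ : ∀ x : (W × M) ⧸ θ.range, ∃ w m, x = I w * J m := by
    intro x
    obtain ⟨⟨w, m⟩, rfl⟩ := QuotientGroup.mk'_surjective _ x
    refine ⟨w, m, ?_⟩
    simp only [I, J, MonoidHom.comp_apply]
    rw [← map_mul]
    simp
  refine ⟨_, inferInstance, I, J, d₀, fun w => rfl, fun m => map_one d, fun k => ?_, ?_, ?_, hIJ⟩
  · simp only [I, J, MonoidHom.comp_apply]
    refine QuotientGroup.eq.mpr ⟨k⁻¹, ?_⟩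
    ext <;> simp [θ]
  · intro m x
    obtain ⟨⟨w, m'⟩, rfl⟩ := QuotientGroup.mk'_surjective _ x
    simp only [J, MonoidHom.comp_apply]
    rw [← map_mul, ← map_mul]
    simp [mul_comm]
  · rw [injective_iff_map_eq_one]
    intro m hm
    obtain ⟨k, hk⟩ := (QuotientGroup.eq_one_iff _).mp hm
    have h1 : (k : W) = 1 := congrArg Prod.fst hk
    have h2 : (ι k)⁻¹ = m := congrArg Prod.snd hk
    have h3 : k = 1 := Subtype.ext h1
    rw [← h2, h3, map_one, inv_one]

end Braiding

/-- A central extension of `V` containing both `W` and `ℚ / ℤ[1/2]`, glued along `ι`, in which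
commutators are given by the braiding `κ` corrected by `β`. -/
structure Braiding.Cover {V W : Type u} [Group V] [Group W] {d : W →* V} (κ : V → V → W)
    (ι : d.ker →* Multiplicative DyadicQuotient) (β : V → V → DyadicQuotient) where
  carrier : Type u
  [group : Group carrier]
  proj : carrier →* V
  incl : W →* carrier
  center : Multiplicative DyadicQuotient →* carrier
  height : carrier → DyadicQuotient
  proj_surjective : Function.Surjective proj
  proj_incl : ∀ w, proj (incl w) = d w
  proj_center : ∀ m, proj (center m) = 1
  incl_ker : ∀ k : d.ker, incl k = center (ι k)
  center_mul : ∀ m x, center m * x = x * center m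
  mul_comm' : ∀ x y, x * y = incl (κ (proj x) (proj y)) *
    center (Multiplicative.ofAdd (-β (proj x) (proj y))) * y * x
  height_mul : ∀ z x, proj z = 1 → height (z * x) = height z + height x
  height_center : ∀ m, height (center m) = Multiplicative.toAdd m

attribute [instance] Braiding.Cover.group

namespace Braiding

variable {V W : Type u} [Group V] [Group W] {d : W →* V} {κ : V → V → W}

/-- A retraction of a central kernel onto a subgroup extends to an equivariant function. -/
theorem exists_height {C : Type u} [Group C] (p : C →* V) (hp : Function.Surjective p)
    (hker : ∀ z x, p z = 1 → z * x = x * z) (j : Multiplicative DyadicQuotient →* C)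
    (hj : Function.Injective j) (hpj : ∀ m, p (j m) = 1) :
    ∃ γ : C → DyadicQuotient, (∀ z x, p z = 1 → γ (z * x) = γ z + γ x) ∧
      ∀ m, γ (j m) = Multiplicative.toAdd m := by
  let _ : CommGroup p.ker :=
    { (inferInstance : Group p.ker) with
      mul_comm := fun a b => Subtype.ext (hker a b a.2) }
  let j' : Multiplicative DyadicQuotient →* p.ker := j.codRestrict p.ker hpj
  obtain ⟨ρ, hρ⟩ := DyadicQuotient.exists_extend (A := Additive p.ker)
    (A' := DyadicQuotient) (MonoidHom.toAdditiveRight j')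
    (fun a b hab => by
      have : j' (Multiplicative.ofAdd a) = j' (Multiplicative.ofAdd b) := hab
      exact hj (congrArg Subtype.val this)) (AddMonoidHom.id _)
  let s : V → C := Function.surjInv hp
  have hs : ∀ v, p (s v) = v := Function.surjInv_eq hp
  let δ : C → p.ker := fun x => ⟨x * (s (p x))⁻¹, by simp [MonoidHom.mem_ker, hs]⟩
  have hδ : ∀ z x (hz : p z = 1), δ (z * x) = ⟨z, hz⟩ * δ x := fun z x hz => by
    apply Subtype.ext
    simp [δ, hz, mul_assoc]
  let γ : C → DyadicQuotient := fun x => ρ (Additive.ofMul (δ x)) - ρ (Additive.ofMul (δ 1))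
  have hγ : ∀ z x (hz : p z = 1), γ (z * x) = ρ (Additive.ofMul ⟨z, hz⟩) + γ x :=
    fun z x hz => by
    simp only [γ]
    rw [hδ z x hz, ofMul_mul, map_add]
    abel
  have hγ' : ∀ z (hz : p z = 1), γ z = ρ (Additive.ofMul ⟨z, hz⟩) := fun z hz => by
    have := hγ z 1 hz
    rw [mul_one] at this
    rw [this]
    simp [γ]
  refine ⟨γ, fun z x hz => ?_, fun m => ?_⟩
  · rw [hγ z x hz, hγ' z hz]
  · rw [hγ' _ (hpj m)]
    exact hρ (Multiplicative.toAdd m)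

theorem exists_cover (h : Braiding d κ) (ι : d.ker →* Multiplicative DyadicQuotient) :
    ∃ β : V → V → DyadicQuotient, (∀ x y z, β (x * y) z = β x z + β y z) ∧
      (∀ x y z, β x (y * z) = β x y + β x z) ∧
      (∀ x w, β x (d w) = 0) ∧ (∀ x w, β (d w) x = 0) ∧ Nonempty (Cover κ ι β) := by
  obtain ⟨β, β_left, β_right, β_d, d_β, β_self, β_sym⟩ := h.exists_bilinear ι
  obtain ⟨W₀, _, I, J, d₀, dI, dJ, IJ, J_comm, J_inj, hex⟩ := h.exists_pushout ι
  let K : V → V → W₀ := fun x y => I (κ x y) * J (Multiplicative.ofAdd (-β x y))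
  have hmul : ∀ a b m n, (I a * J m) * (I b * J n) = I (a * b) * J (m * n) := fun a b m n => by
    rw [mul_assoc, ← mul_assoc (J m), J_comm m (I b), map_mul, map_mul]
    simp only [mul_assoc]
  have hinv : ∀ a m, (I a * J m)⁻¹ = I a⁻¹ * J m⁻¹ := fun a m => by
    rw [mul_inv_rev, ← map_inv, ← map_inv, J_comm]
  have dK : ∀ x y, d₀ (K x y) = d (κ x y) := fun x y => by
    simp only [K, map_mul, dI, dJ, mul_one]
  have d_eq : ∀ a m, d₀ (I a * J m) = d a := fun a m => by rw [map_mul, dI, dJ, mul_one]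
  have hq : ∀ x, d (κ x x) = 1 := fun x => by rw [h.boundary]; group
  have hK : StrictBraiding d₀ K := by
    refine ⟨fun x y z => ?_, fun x y z => ?_, fun x => ?_, fun x y => ?_, fun x y => ?_,
      fun w w' => ?_⟩
    · rw [dK]
      simp only [K]
      rw [hmul, hmul, β_left, β_d, h.map_mul_left]
      congr 2
      rw [← ofAdd_add, ← ofAdd_add]
      congr 1
      abel
    · rw [dK]
      simp only [K]
      rw [hmul, hmul, β_right, β_d, h.map_mul_right]
      congr 2
      rw [← ofAdd_add, ← ofAdd_add]
      congr 1
      abel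
    · have := IJ ⟨κ x x, hq x⟩
      rw [← β_self] at this
      simp only [K]
      rw [this, ← map_mul, ← ofAdd_add]
      simp
    · have := IJ ⟨_, h.boundary_sym x y⟩
      rw [← β_sym] at this
      simp only [K]
      rw [hmul, this, ← map_mul, ← ofAdd_add, ← ofAdd_add]
      have : β x y + β y x + (-β x y + -β y x) = 0 := by abel
      rw [this]
      simp
    · rw [dK, h.boundary]
    · obtain ⟨a, m, rfl⟩ := hex w
      obtain ⟨b, n, rfl⟩ := hex w'
      rw [d_eq, d_eq, hinv, hinv, hmul, hmul, hmul]
      simp only [K, β_d, h.peiffer]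
      congr 2
      simp
  obtain ⟨C, hC⟩ := Realization.exists_surjective hK
  have hker : ∀ z x, C.proj z = 1 → z * x = x * z := fun z x hz => by
    have := C.mul_comm' z x
    rwa [hz, hK.one_left, map_one, one_mul] at this
  have pJ : ∀ m, C.proj (C.incl (J m)) = 1 := fun m => by rw [C.proj_incl, dJ]
  obtain ⟨γ, hγ, hγJ⟩ := exists_height C.proj hC hker (C.incl.comp J)
    (C.incl_injective.comp J_inj) pJ
  refine ⟨β, β_left, β_right, β_d, d_β, ⟨⟨C.carrier, C.proj, C.incl.comp I, C.incl.comp J, γ, hC,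
    fun w => ?_, pJ, fun k => ?_, fun m x => hker _ _ (pJ m), fun x y => ?_, hγ, hγJ⟩⟩⟩
  · rw [MonoidHom.comp_apply, C.proj_incl, dI]
  · rw [MonoidHom.comp_apply, IJ]; rfl
  · rw [C.mul_comm' x y]
    simp [K]

end Braiding

/-! ### Functions whose differences split -/

section Splitting

variable {G : Type u} [Group G] {B : Type*} [AddCommGroup B] {R S T : Subgroup G}

/-- Invariance of a function under left translation by a subgroup. -/
def LeftInvariant (H : Subgroup G) (x : G → B) : Prop := ∀ r ∈ H, ∀ g, x (r * g) = x g

/-- The function is a sum of an `R`-invariant and an `S`-invariant one. -/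
def SplitSum (R S : Subgroup G) (F : G → B) : Prop :=
  ∃ x y, LeftInvariant R x ∧ LeftInvariant S y ∧ ∀ g, F g = x g + y g

theorem SplitSum.symm {F : G → B} (h : SplitSum R S F) : SplitSum S R F := by
  obtain ⟨x, y, hx, hy, h⟩ := h
  exact ⟨y, x, hy, hx, fun g => by rw [h, add_comm]⟩

/-- Each translation difference of `f` along one of the three subgroups splits along the other
two. -/
structure TripleSplit (R S T : Subgroup G) (f : G → B) : Prop where
  third : ∀ t ∈ T, SplitSum R S fun g => f (t * g) - f g
  first : ∀ r ∈ R, SplitSum S T fun g => f (r * g) - f g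
  second : ∀ s ∈ S, SplitSum T R fun g => f (s * g) - f g

theorem TripleSplit.rotate {f : G → B} (h : TripleSplit R S T f) : TripleSplit S T R f :=
  ⟨h.first, h.second, h.third⟩

/-- The intersection of any two of the subgroups commutes with the third one. -/
structure TripleCentral (R S T : Subgroup G) : Prop where
  third : ∀ a ∈ R ⊓ S, ∀ t ∈ T, a * t = t * a
  first : ∀ a ∈ S ⊓ T, ∀ r ∈ R, a * r = r * a
  second : ∀ a ∈ T ⊓ R, ∀ s ∈ S, a * s = s * a

theorem TripleCentral.rotate (h : TripleCentral R S T) : TripleCentral S T R :=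
  ⟨h.first, h.second, h.third⟩

end Splitting

/-! ### The case of pairwise complementary subgroups -/

section Pairwise

variable {G : Type u} [Group G] {R S T : Subgroup G}

theorem exists_mul_of_sup_eq_top [S.Normal] (h : R ⊔ S = ⊤) (g : G) :
    ∃ r ∈ R, ∃ s ∈ S, r * s = g := by
  have : g ∈ R ⊔ S := h ▸ Subgroup.mem_top g
  exact Subgroup.mem_sup_of_normal_right.mp this

theorem exists_mk_eq_of_sup_eq_top [T.Normal] (h : R ⊔ T = ⊤) (x : G ⧸ T) :
    ∃ r ∈ R, (QuotientGroup.mk r : G ⧸ T) = x := by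
  obtain ⟨g, rfl⟩ := QuotientGroup.mk_surjective x
  obtain ⟨r, hr, t, ht, rfl⟩ := exists_mul_of_sup_eq_top h g
  exact ⟨r, hr, QuotientGroup.eq.mpr (by simpa using ht)⟩

theorem TripleCentral.commutator_eq [T.Normal] (hc : TripleCentral R S T) {r r' s s' : G}
    (hr : r ∈ R) (hr' : r' ∈ R) (hs : s ∈ S) (hs' : s' ∈ S) (h1 : (r : G ⧸ T) = r')
    (h2 : (s : G ⧸ T) = s') :
    r * s * r⁻¹ * s⁻¹ = r' * s' * r'⁻¹ * s'⁻¹ := by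
  have hq : r⁻¹ * r' ∈ T ⊓ R :=
    Subgroup.mem_inf.mpr ⟨QuotientGroup.eq.mp h1, mul_mem (inv_mem hr) hr'⟩
  have hp : s⁻¹ * s' ∈ S ⊓ T :=
    Subgroup.mem_inf.mpr ⟨mul_mem (inv_mem hs) hs', QuotientGroup.eq.mp h2⟩
  have e1 := hc.second _ hq s' hs'
  have e2 := hc.first _ hp r⁻¹ (inv_mem hr)
  calc r * s * r⁻¹ * s⁻¹ = r * s * (r⁻¹ * (s⁻¹ * s')) * s'⁻¹ := by group
    _ = r * s' * (r⁻¹ * r') * r'⁻¹ * s'⁻¹ := by rw [← e2]; group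
    _ = r * (s' * (r⁻¹ * r')) * r'⁻¹ * s'⁻¹ := by group
    _ = _ := by rw [← e1]; group

/-- The commutator pairing `G ⧸ T × G ⧸ T → R ⊓ S` is a braiding. -/
theorem TripleCentral.exists_braiding [R.Normal] [S.Normal] [T.Normal]
    (hc : TripleCentral R S T) (hRT : R ⊔ T = ⊤)
    (hST : S ⊔ T = ⊤) :
    ∃ κ : G ⧸ T → G ⧸ T → ↥(R ⊓ S),
      Braiding ((QuotientGroup.mk' T).comp (R ⊓ S).subtype) κ ∧
      ∀ r ∈ R, ∀ s ∈ S, (κ r s : G) = r * s * r⁻¹ * s⁻¹ := by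
  choose ρ hρ ρ_mk using exists_mk_eq_of_sup_eq_top hRT
  choose σ hσ σ_mk using exists_mk_eq_of_sup_eq_top hST
  let κ : G ⧸ T → G ⧸ T → ↥(R ⊓ S) := fun x y =>
    ⟨ρ x * σ y * (ρ x)⁻¹ * (σ y)⁻¹, Subgroup.mem_inf.mpr ⟨by
        have := mul_mem (hρ x) (Subgroup.Normal.conj_mem ‹R.Normal› _ (inv_mem (hρ x)) (σ y))
        simpa only [mul_assoc] using this,
      mul_mem (Subgroup.Normal.conj_mem ‹S.Normal› _ (hσ y) (ρ x)) (inv_mem (hσ y))⟩⟩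
  have hκ : ∀ r ∈ R, ∀ s ∈ S, (κ r s : G) = r * s * r⁻¹ * s⁻¹ := fun r hr s hs =>
    hc.commutator_eq (hρ _) hr (hσ _) hs (ρ_mk _) (σ_mk _)
  have hκ' : ∀ x y r s, r ∈ R → s ∈ S → (r : G ⧸ T) = x → (s : G ⧸ T) = y →
      (κ x y : G) = r * s * r⁻¹ * s⁻¹ := by
    rintro _ _ r s hr hs rfl rfl
    exact hκ r hr s hs
  have hd : ∀ w : ↥(R ⊓ S), ((QuotientGroup.mk' T).comp (R ⊓ S).subtype) w = ((w : G) : G ⧸ T) :=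
    fun _ => rfl
  refine ⟨κ, ⟨fun x y z => ?_, fun x y z => ?_, fun x y => ?_, fun w w' => ?_, fun x w => ?_⟩, hκ⟩
  · apply Subtype.ext
    push_cast
    simp only [hd]
    rw [hκ' (x * y) z (ρ x * ρ y) (σ z) (mul_mem (hρ x) (hρ y)) (hσ z)
      (by rw [QuotientGroup.mk_mul, ρ_mk, ρ_mk]) (σ_mk z),
      hκ' x _ (ρ x) (κ y z) (hρ x) (κ y z).2.2 (ρ_mk x) rfl,
      hκ' y z (ρ y) (σ z) (hρ y) (hσ z) (ρ_mk y) (σ_mk z),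
      hκ' x z (ρ x) (σ z) (hρ x) (hσ z) (ρ_mk x) (σ_mk z)]
    group
  · apply Subtype.ext
    push_cast
    simp only [hd]
    have e : ρ y * (κ x z : G) * (ρ y)⁻¹ = σ y * (κ x z : G) * (σ y)⁻¹ := by
      have ht : (σ y)⁻¹ * ρ y ∈ T := QuotientGroup.eq.mp (by rw [σ_mk, ρ_mk])
      have := hc.third _ (κ x z).2 _ ht
      calc _ = σ y * ((σ y)⁻¹ * ρ y * (κ x z : G)) * (ρ y)⁻¹ := by group
        _ = _ := by rw [← this]; group
    rw [hκ' x (y * z) (ρ x) (σ y * σ z) (hρ x) (mul_mem (hσ y) (hσ z)) (ρ_mk x)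
      (by rw [QuotientGroup.mk_mul, σ_mk, σ_mk]),
      hκ' y _ (ρ y) (κ x z) (hρ y) (κ x z).2.2 (ρ_mk y) rfl, inv_mul_cancel_right, e,
      hκ' x y (ρ x) (σ y) (hρ x) (hσ y) (ρ_mk x) (σ_mk y),
      hκ' x z (ρ x) (σ z) (hρ x) (hσ z) (ρ_mk x) (σ_mk z)]
    group
  · show ((κ x y : G) : G ⧸ T) = _
    rw [hκ' x y (ρ x) (σ y) (hρ x) (hσ y) (ρ_mk x) (σ_mk y)]
    simp only [QuotientGroup.mk_mul, QuotientGroup.mk_inv, ρ_mk, σ_mk]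
  · exact Subtype.ext (hκ w w.2.1 w' w'.2.2)
  · apply Subtype.ext
    push_cast
    simp only [hd]
    rw [hκ' x _ (ρ x) w (hρ x) w.2.2 (ρ_mk x) rfl, hκ' _ x w (σ x) w.2.1 (hσ x) rfl (σ_mk x)]
    have ht : (ρ x)⁻¹ * σ x ∈ T := QuotientGroup.eq.mp (by rw [σ_mk, ρ_mk])
    have := hc.third _ w.2 _ ht
    calc _ = ρ x * ((w : G) * ((ρ x)⁻¹ * σ x)) * (w : G)⁻¹ * (σ x)⁻¹ := by group
      _ = 1 := by rw [this]; group

end Pairwise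

namespace Braiding.Cover

variable {V W : Type u} [Group V] [Group W] {d : W →* V} {κ : V → V → W}
  {ι : d.ker →* Multiplicative DyadicQuotient} {β : V → V → DyadicQuotient}

theorem mul_eq_of_proj_eq_one (C : Cover κ ι β) (h : Braiding d κ)
    (hβ : ∀ x w, β (d w) x = 0) {z : C.carrier} (hz : C.proj z = 1) (x : C.carrier) :
    z * x = x * z := by
  have h1 := hβ (C.proj x) 1
  rw [map_one] at h1
  have := C.mul_comm' z x
  rwa [hz, h.one_left, h1, neg_zero, ofAdd_zero, map_one, map_one, one_mul, one_mul] at this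

theorem mul_incl (C : Cover κ ι β) (hβ : ∀ x w, β x (d w) = 0) (x : C.carrier) (w : W) :
    x * C.incl w = C.incl (κ (C.proj x) (d w) * w) * x := by
  rw [C.mul_comm' x (C.incl w), C.proj_incl, hβ, neg_zero, ofAdd_zero, map_one, mul_one, map_mul]

/-- The change of height under left translation only depends on the projection. -/
theorem exists_shift (C : Cover κ ι β) (h : Braiding d κ) (hβ : ∀ x w, β (d w) x = 0) :
    ∃ θ : C.carrier → V → DyadicQuotient,
      ∀ c x, C.height (c * x) = θ c (C.proj x) + C.height x := by
  let s : V → C.carrier := Function.surjInv C.proj_surjective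
  have hs : ∀ v, C.proj (s v) = v := Function.surjInv_eq C.proj_surjective
  refine ⟨fun c v => C.height (c * s v) - C.height (s v), fun c x => ?_⟩
  have hz : C.proj (x * (s (C.proj x))⁻¹) = 1 := by rw [map_mul, map_inv, hs, mul_inv_cancel]
  have e : x = x * (s (C.proj x))⁻¹ * s (C.proj x) := by group
  have h1 : C.height x = _ := (congrArg C.height e).trans (C.height_mul _ (s (C.proj x)) hz)
  have h2 : C.height (c * x) = C.height (x * (s (C.proj x))⁻¹) +
      C.height (c * s (C.proj x)) := by
    rw [← C.height_mul _ _ hz]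
    congr 1
    rw [← mul_assoc, C.mul_eq_of_proj_eq_one h hβ hz c]
    group
  rw [h2, h1]
  beta_reduce
  rw [sub_add_add_cancel, add_comm]

end Braiding.Cover

section Pairwise

variable {G : Type u} [Group G] {R S T : Subgroup G}

/-- A lift of the quotient map that is equivariant for right translations by a subgroup. -/
theorem exists_equivariant_lift {C : Type*} [Group C] {V : Type*} [Group V] (p : C →* V)
    (hp : Function.Surjective p) (π : G →* V) (H : Subgroup G) (i : H →* C)
    (hi : ∀ w, p (i w) = π w) :
    ∃ c : G → C, (∀ g, p (c g) = π g) ∧ ∀ g, ∀ w : H, c (g * w) = c g * i w := by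
  have hout : ∀ g : G, ((g : G ⧸ H).out)⁻¹ * g ∈ H := fun g =>
    QuotientGroup.eq.mp (QuotientGroup.out_eq' _)
  refine ⟨fun g => Function.surjInv hp (π (g : G ⧸ H).out) * i ⟨_, hout g⟩, fun g => ?_,
    fun g w => ?_⟩
  · rw [map_mul, Function.surjInv_eq hp, hi, ← map_mul, mul_inv_cancel_left]
  · have e : ((g * w : G) : G ⧸ H) = g := QuotientGroup.eq.mpr (by simp)
    have : (⟨_, hout (g * w)⟩ : H) = ⟨_, hout g⟩ * w := by
      apply Subtype.ext
      push_cast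
      rw [e, mul_assoc]
    beta_reduce
    rw [this, e, map_mul, mul_assoc]

variable [R.Normal] [S.Normal] [T.Normal]

theorem TripleCentral.exists_tripleSplit_of_sup_eq_top (hc : TripleCentral R S T)
    (hRS : R ⊔ S = ⊤) (hRT : R ⊔ T = ⊤) (hST : S ⊔ T = ⊤) (ι : G → DyadicQuotient)
    (hι : ∀ a ∈ R ⊓ S ⊓ T, ∀ b ∈ R ⊓ S ⊓ T, ι (a * b) = ι a + ι b) :
    ∃ f : G → DyadicQuotient, TripleSplit R S T f ∧
      ∀ a ∈ R ⊓ S ⊓ T, ∀ g, f (a * g) = ι a + f g := by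
  obtain ⟨κ, hκ, κ_eq⟩ := hc.exists_braiding hRT hST
  set d : ↥(R ⊓ S) →* G ⧸ T := (QuotientGroup.mk' T).comp (R ⊓ S).subtype with hd
  have d_eq : ∀ w, d w = ((w : G) : G ⧸ T) := fun _ => rfl
  have mem_ker : ∀ k : d.ker, ((k : ↥(R ⊓ S)) : G) ∈ R ⊓ S ⊓ T := fun k =>
    Subgroup.mem_inf.mpr ⟨k.1.2, (QuotientGroup.eq_one_iff _).mp k.2⟩
  let ι' : d.ker →* Multiplicative DyadicQuotient :=
    { toFun := fun k => Multiplicative.ofAdd (ι (k : ↥(R ⊓ S)))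
      map_one' := by
        have := hι 1 (one_mem _) 1 (one_mem _)
        rw [mul_one, left_eq_add] at this
        exact congrArg _ this
      map_mul' := fun a b => congrArg _ (hι _ (mem_ker a) _ (mem_ker b)) }
  obtain ⟨β, β_left, β_right, β_d, d_β, ⟨C⟩⟩ := hκ.exists_cover ι'
  obtain ⟨θ, hθ⟩ := C.exists_shift hκ d_β
  obtain ⟨cR, p_cR, cR_mul⟩ := exists_equivariant_lift C.proj C.proj_surjective
    (QuotientGroup.mk' T) (R ⊓ S) C.incl (fun w => by rw [C.proj_incl]; rfl)
  replace p_cR : ∀ g, C.proj (cR g) = (g : G ⧸ T) := p_cR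
  obtain ⟨cS, p_cS, cS_mul⟩ : ∃ cS : G → C.carrier, (∀ s, C.proj (cS s) = (s : G ⧸ T)) ∧
      ∀ (w : ↥(R ⊓ S)) (s : G), cS (w * s) = C.incl w * cS s := by
    refine ⟨fun s => (cR s⁻¹)⁻¹, fun s => ?_, fun w s => ?_⟩
    · rw [map_inv, p_cR, QuotientGroup.mk_inv, inv_inv]
    · have := cR_mul s⁻¹ w⁻¹
      beta_reduce
      rw [mul_inv_rev, ← Subgroup.coe_inv, this, mul_inv_rev, map_inv, inv_inv]
  have central := fun {z} => C.mul_eq_of_proj_eq_one hκ d_β (z := z)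
  have conj_mem : ∀ (g : G) (w : ↥(R ⊓ S)), g * w * g⁻¹ ∈ R ⊓ S := fun g w =>
    Subgroup.Normal.conj_mem inferInstance _ w.2 g
  have conj : ∀ (c : C.carrier) (g : G) (w : ↥(R ⊓ S)), C.proj c = (g : G ⧸ T) →
      c * C.incl w = C.incl ⟨g * w * g⁻¹, conj_mem g w⟩ * c := by
    intro c g w hcg
    rw [C.mul_incl β_d]
    congr 2
    apply Subtype.ext
    obtain ⟨r, hr, hrg⟩ := exists_mk_eq_of_sup_eq_top hRT (g : G ⧸ T)
    push_cast
    rw [hcg, ← hrg, d_eq, κ_eq r hr w w.2.2]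
    have ht := hc.third _ w.2 _ (QuotientGroup.eq.mp hrg)
    calc r * w * r⁻¹ * (w : G)⁻¹ * w = r * (w * (r⁻¹ * g)) * g⁻¹ := by group
      _ = _ := by rw [ht]; group
  choose ρ hρ σ hσ ρσ using exists_mul_of_sup_eq_top hRS
  -- functions of the two factors descend to the group
  have right_mem : ∀ r ∈ R, ∀ s ∈ S, ∃ w : ↥(R ⊓ S), ρ (r * s) = r * w ∧
      s = w * σ (r * s) := fun r hr s hs => by
    have e := ρσ (r * s)
    have e2 : r⁻¹ * ρ (r * s) = s * (σ (r * s))⁻¹ := by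
      calc r⁻¹ * ρ (r * s) = r⁻¹ * (ρ (r * s) * σ (r * s)) * (σ (r * s))⁻¹ := by group
        _ = _ := by rw [e]; group
    exact ⟨⟨r⁻¹ * ρ (r * s), Subgroup.mem_inf.mpr ⟨mul_mem (inv_mem hr) (hρ _),
      e2 ▸ mul_mem hs (inv_mem (hσ _))⟩⟩, by simp, by simp [e2]⟩
  have descend_R : ∀ D : G → DyadicQuotient, (∀ r ∈ R, ∀ w : ↥(R ⊓ S), D (r * w) = D r) →
      (∀ r ∈ R, ∀ s ∈ S, D (ρ (r * s)) = D r) ∧ LeftInvariant S fun g => D (ρ g) := by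
    intro D hD
    have h1 : ∀ r ∈ R, ∀ s ∈ S, D (ρ (r * s)) = D r := fun r hr s hs => by
      obtain ⟨w, hw, -⟩ := right_mem r hr s hs
      rw [hw, hD r hr]
    refine ⟨h1, fun s hs g => ?_⟩
    have h2 := h1 (ρ g) (hρ g) ((ρ g)⁻¹ * s * ρ g * σ g)
      (mul_mem (by simpa using Subgroup.Normal.conj_mem ‹S.Normal› s hs (ρ g)⁻¹) (hσ g))
    have e : ρ g * ((ρ g)⁻¹ * s * ρ g * σ g) = s * g := by
      calc _ = s * (ρ g * σ g) := by group
        _ = _ := by rw [ρσ]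
    rwa [e] at h2
  have descend_S : ∀ D : G → DyadicQuotient, (∀ s ∈ S, ∀ w : ↥(R ⊓ S), D (w * s) = D s) →
      (∀ r ∈ R, ∀ s ∈ S, D (σ (r * s)) = D s) ∧ LeftInvariant R fun g => D (σ g) := by
    intro D hD
    have h1 : ∀ r ∈ R, ∀ s ∈ S, D (σ (r * s)) = D s := fun r hr s hs => by
      obtain ⟨w, -, hw⟩ := right_mem r hr s hs
      conv_rhs => rw [hw, hD _ (hσ _)]
    refine ⟨h1, fun r hr g => ?_⟩
    have h2 := h1 (r * ρ g) (mul_mem hr (hρ g)) (σ g) (hσ g)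
    rw [mul_assoc, ρσ] at h2
    exact h2
  let f : G → DyadicQuotient := fun g => C.height (cR (ρ g) * cS (σ g))
  have hf : ∀ r ∈ R, ∀ s ∈ S, f (r * s) = C.height (cR r * cS s) := fun r hr s hs => by
    obtain ⟨w, h1, h2⟩ := right_mem r hr s hs
    simp only [f]
    rw [h1, cR_mul, mul_assoc, ← cS_mul, ← h2]
  -- defect of the two lifts from being homomorphisms
  let δR : G → G → DyadicQuotient := fun r' r => C.height (cR (r' * r) * (cR r' * cR r)⁻¹)
  let δS : G → G → DyadicQuotient := fun s' s => C.height (cS (s' * s) * (cS s' * cS s)⁻¹)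
  have zR : ∀ r' r, C.proj (cR (r' * r) * (cR r' * cR r)⁻¹) = 1 := fun r' r => by
    rw [map_mul, map_inv, map_mul, p_cR, p_cR, p_cR, QuotientGroup.mk_mul, mul_inv_cancel]
  have zS : ∀ r' r, C.proj (cS (r' * r) * (cS r' * cS r)⁻¹) = 1 := fun r' r => by
    rw [map_mul, map_inv, map_mul, p_cS, p_cS, p_cS, QuotientGroup.mk_mul, mul_inv_cancel]
  have δR_mul : ∀ r', ∀ r ∈ R, ∀ w : ↥(R ⊓ S), δR r' (r * w) = δR r' r := fun r' r _ w => by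
    simp only [δR]
    congr 1
    rw [← mul_assoc, cR_mul, cR_mul]
    group
  have δS_mul : ∀ s', ∀ s ∈ S, ∀ w : ↥(R ⊓ S), δS s' (w * s) = δS s' s := fun s' s _ w => by
    simp only [δS]
    congr 1
    have e : s' * (w * s) = (⟨s' * w * s'⁻¹, conj_mem s' w⟩ : ↥(R ⊓ S)) * (s' * s) := by
      simp only
      group
    rw [e, cS_mul, cS_mul, ← mul_assoc (cS s'), conj _ s' w (p_cS s')]
    have hz := central (zS s' s) (C.incl ⟨s' * w * s'⁻¹, conj_mem s' w⟩)
    generalize C.incl ⟨s' * w * s'⁻¹, conj_mem s' w⟩ = x at hz ⊢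
    calc _ = x * (cS (s' * s) * (cS s' * cS s)⁻¹) * x⁻¹ := by group
      _ = _ := by rw [← hz]; group
  have mk_eq : ∀ r s, C.proj (cR r * cS s) = ((r * s : G) : G ⧸ T) := fun r s => by
    rw [map_mul, p_cR, p_cS, QuotientGroup.mk_mul]
  have f_R : ∀ r' ∈ R, ∀ g : G, f (r' * g) - f g = δR r' (ρ g) + θ (cR r') g := by
    intro r' hr' g
    have e1 := hf (r' * ρ g) (mul_mem hr' (hρ g)) (σ g) (hσ g)
    rw [mul_assoc, ρσ] at e1
    have e2 : f g = C.height (cR (ρ g) * cS (σ g)) := rfl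
    have e3 : cR (r' * ρ g) * cS (σ g) = (cR (r' * ρ g) * (cR r' * cR (ρ g))⁻¹) *
        (cR r' * (cR (ρ g) * cS (σ g))) := by group
    rw [e1, e2, e3, C.height_mul _ _ (zR _ _), hθ (cR r'), mk_eq, ρσ]
    abel
  have f_S : ∀ s' ∈ S, ∀ g : G, f (s' * g) - f g =
      δS s' (σ g) - β (ρ g) s' + θ (cS s') g := by
    intro s' hs' g
    have hu : (ρ g)⁻¹ * s' * ρ g * s'⁻¹ ∈ R ⊓ S := Subgroup.mem_inf.mpr
      ⟨by
        have := mul_mem (inv_mem (hρ g)) (Subgroup.Normal.conj_mem ‹R.Normal› _ (hρ g) s')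
        simpa only [mul_assoc] using this,
      mul_mem (by simpa using Subgroup.Normal.conj_mem ‹S.Normal› s' hs' (ρ g)⁻¹)
        (inv_mem hs')⟩
    have e1 := hf (ρ g) (hρ g) ((ρ g)⁻¹ * s' * ρ g * s'⁻¹ * (s' * σ g))
      (mul_mem hu.2 (mul_mem hs' (hσ g)))
    have e1' : ρ g * ((ρ g)⁻¹ * s' * ρ g * s'⁻¹ * (s' * σ g)) = s' * g := by
      calc _ = s' * (ρ g * σ g) := by group
        _ = _ := by rw [ρσ]
    have e2 : f g = C.height (cR (ρ g) * cS (σ g)) := rfl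
    have e3 : cR (ρ g) * C.incl ⟨_, hu⟩ * cS s' =
        C.center (Multiplicative.ofAdd (-β (ρ g) s')) * (cS s' * cR (ρ g)) := by
      rw [conj _ (ρ g) _ (p_cR _), mul_assoc, C.mul_comm' (cR (ρ g)) (cS s'), p_cR, p_cS]
      rw [mul_assoc (C.incl (κ _ _) * _), mul_assoc (C.incl (κ _ _)), ← mul_assoc, ← map_mul]
      have : (⟨ρ g * ((ρ g)⁻¹ * s' * ρ g * s'⁻¹) * (ρ g)⁻¹, conj_mem _ ⟨_, hu⟩⟩ : ↥(R ⊓ S)) *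
          κ (ρ g) s' = 1 := by
        apply Subtype.ext
        push_cast
        rw [κ_eq _ (hρ g) _ hs']
        group
      rw [this, map_one, one_mul]
    have e4 : cR (ρ g) * (C.incl ⟨_, hu⟩ * cS (s' * σ g)) =
        (cS (s' * σ g) * (cS s' * cS (σ g))⁻¹) *
        (C.center (Multiplicative.ofAdd (-β (ρ g) s')) *
          (cS s' * (cR (ρ g) * cS (σ g)))) := by
      have hz := central (zS s' (σ g)) (cR (ρ g) * C.incl ⟨_, hu⟩)
      calc _ = cR (ρ g) * C.incl ⟨_, hu⟩ * (cS (s' * σ g) * (cS s' * cS (σ g))⁻¹) *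
            (cS s' * cS (σ g)) := by group
        _ = (cS (s' * σ g) * (cS s' * cS (σ g))⁻¹) *
            ((cR (ρ g) * C.incl ⟨_, hu⟩ * cS s') * cS (σ g)) := by rw [← hz]; group
        _ = _ := by rw [e3]; simp only [mul_assoc]
    rw [e1', cS_mul ⟨_, hu⟩, e4, C.height_mul _ _ (zS _ _), C.height_mul _ _ (C.proj_center _),
      C.height_center, hθ (cS s'), mk_eq, ρσ] at e1
    rw [e1, e2]
    simp only [δS, toAdd_ofAdd]
    abel
  have β_mul : ∀ s', ∀ r ∈ R, ∀ w : ↥(R ⊓ S),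
      β ((r * w : G) : G ⧸ T) s' = β (r : G ⧸ T) s' := fun s' r _ w => by
    rw [QuotientGroup.mk_mul, β_left, ← d_eq, d_β, add_zero]
  have β_mul' : ∀ s', ∀ s ∈ S, ∀ w : ↥(R ⊓ S),
      β ((w * s : G) : G ⧸ T) s' = β (s : G ⧸ T) s' := fun s' s _ w => by
    rw [QuotientGroup.mk_mul, β_left, ← d_eq, d_β, zero_add]
  have T_inv : ∀ D : G ⧸ T → DyadicQuotient, LeftInvariant T fun g => D g := fun D t ht g => by
    simp only [QuotientGroup.mk_mul, (QuotientGroup.eq_one_iff t).mpr ht, one_mul]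
  refine ⟨f, ⟨fun t ht => ?_, fun r hr => ?_, fun s hs => ?_⟩, fun a ha g => ?_⟩
  · refine ⟨fun g => δS (σ t) (σ g), fun g => δR (ρ t) (ρ g) - β (ρ g) (σ t : G) +
      C.height (cR (ρ t) * cS (σ t)), (descend_S _ (δS_mul _)).2, ?_, fun g => ?_⟩
    · intro s hs g
      have h1 := (descend_R _ (δR_mul (ρ t))).2 s hs g
      have h2 := (descend_R (fun x => β x (σ t : G)) (β_mul (σ t : G))).2 s hs g
      simp only at h1 h2 ⊢
      rw [h1, h2]
    · have h1 := f_R (ρ t) (hρ t) (σ t * g)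
      have h2 := f_S (σ t) (hσ t) g
      have h3 := (descend_R _ (δR_mul (ρ t))).2 (σ t) (hσ t) g
      rw [← mul_assoc, ρσ] at h1
      simp only at h3
      rw [h3] at h1
      have hz : C.proj (cR (ρ t) * cS (σ t)) = 1 := by
        rw [mk_eq, ρσ]
        exact (QuotientGroup.eq_one_iff t).mpr ht
      obtain ⟨x, hx⟩ := C.proj_surjective (g : G ⧸ T)
      have h4 := C.height_mul _ x hz
      have h5 := hθ (cR (ρ t)) (cS (σ t) * x)
      rw [← mul_assoc, h4, map_mul, p_cS, hx, ← QuotientGroup.mk_mul, hθ (cS (σ t)) x, hx] at h5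
      have h6 : C.height (cR (ρ t) * cS (σ t)) =
          θ (cR (ρ t)) (σ t * g : G) + θ (cS (σ t)) g := by
        have := add_right_cancel (h5.trans (add_assoc _ _ _).symm)
        exact this
      rw [h6]
      calc f (t * g) - f g = (f (t * g) - f (σ t * g)) + (f (σ t * g) - f g) := by abel
        _ = _ := by rw [h1, h2]; beta_reduce; abel
  · exact ⟨fun g => δR r (ρ g), fun g => θ (cR r) g, (descend_R _ (δR_mul r)).2, T_inv _,
      fun g => f_R r hr g⟩
  · refine ⟨fun g => θ (cS s) g - β g s, fun g => δS s (σ g) + β (σ g) s,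
      T_inv fun x => θ (cS s) x - β x s, ?_, fun g => ?_⟩
    · exact (descend_S (fun x => δS s x + β x s) (fun x hx w => by
        rw [δS_mul s x hx w, β_mul' s x hx w])).2
    · beta_reduce
      rw [f_S s hs g]
      have : β g s = β (ρ g) s + β (σ g) s := by
        rw [← β_left, ← QuotientGroup.mk_mul, ρσ]
      rw [this]
      abel
  · have ha' := Subgroup.mem_inf.mp ha
    have hcomm := hc.first a (Subgroup.mem_inf.mpr ⟨ha'.1.2, ha'.2⟩) (ρ g) (hρ g)
    have e1 := hf (a * ρ g) (mul_mem ha'.1.1 (hρ g)) (σ g) (hσ g)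
    let k : d.ker := ⟨⟨a, ha'.1⟩, (QuotientGroup.eq_one_iff _).mpr ha'.2⟩
    have e2 : cR (a * ρ g) = C.center (ι' k) * cR (ρ g) := by
      rw [hcomm, C.center_mul, ← C.incl_ker]
      exact cR_mul (ρ g) k.1
    rw [mul_assoc, ρσ, e2, mul_assoc, C.height_mul _ _ (C.proj_center _), C.height_center] at e1
    exact e1

end Pairwise

/-! ### Reduction to pairwise complementary subgroups -/

section Reduction

variable {G : Type u} [Group G] {R S T : Subgroup G}

theorem LeftInvariant.comp {B H : Type*} [Group H] {K : Subgroup G} {L : Subgroup H} {x : G → B}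
    (hx : LeftInvariant K x) {k : H → G}
    (hk : ∀ r ∈ L, ∀ g, ∃ r' ∈ K, k (r * g) = r' * k g) : LeftInvariant L (x ∘ k) := by
  intro r hr g
  obtain ⟨r', hr', e⟩ := hk r hr g
  simp only [Function.comp_apply, e, hx r' hr']

variable {B : Type*} [AddCommGroup B]

theorem TripleSplit.swap {f : G → B} (h : TripleSplit R S T f) : TripleSplit S R T f :=
  ⟨fun t ht => (h.third t ht).symm, fun s hs => (h.second s hs).symm,
    fun r hr => (h.first r hr).symm⟩

theorem TripleCentral.swap (h : TripleCentral R S T) : TripleCentral S R T :=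
  ⟨fun a ha => h.third a (inf_comm S R ▸ ha), fun a ha => h.second a (inf_comm R T ▸ ha),
    fun a ha => h.first a (inf_comm T S ▸ ha)⟩

/-- A function splitting along the three subgroups which restricts to a translate of `ι` along
their intersection. -/
structure TripleExtension (R S T : Subgroup G) (ι f : G → B) : Prop where
  split : TripleSplit R S T f
  translate : ∀ a ∈ R ⊓ S ⊓ T, ∀ g, f (a * g) = ι a + f g

theorem TripleExtension.rotate {ι f : G → B} (h : TripleExtension R S T ι f) :
    TripleExtension S T R ι f :=
  ⟨h.split.rotate, fun a ha => h.translate a (by rwa [inf_comm, ← inf_assoc] at ha)⟩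

/-- A choice of elements of `T`, constant on cosets of `Q`, moving each coset of `Q` to a
representative of its coset modulo `Q ⊔ T`. -/
theorem exists_translation (Q T : Subgroup G) [Q.Normal] [T.Normal] :
    ∃ τ : G → G, (∀ g, τ g ∈ T) ∧ (∀ q ∈ Q, ∀ g, τ (q * g) = τ g) ∧
      ∀ t ∈ T, ∀ g, (τ (t * g))⁻¹ * t * τ g ∈ Q := by
  have : (T.map (QuotientGroup.mk' Q)).Normal :=
    Subgroup.Normal.map inferInstance _ (QuotientGroup.mk'_surjective Q)
  let c : G ⧸ Q → G ⧸ Q := fun X => (QuotientGroup.mk X : (G ⧸ Q) ⧸ T.map (QuotientGroup.mk' Q)).out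
  have hc : ∀ X : G ⧸ Q, ∃ t ∈ T, (t : G ⧸ Q) = X * (c X)⁻¹ := by
    intro X
    have h : (c X)⁻¹ * X ∈ T.map (QuotientGroup.mk' Q) :=
      QuotientGroup.eq.mp (QuotientGroup.out_eq' _)
    obtain ⟨t, ht, e⟩ := (Subgroup.Normal.mem_comm_iff this).mp h
    exact ⟨t, ht, e⟩
  choose θ hθ θ_mk using hc
  have hcT : ∀ t ∈ T, ∀ X : G ⧸ Q, c (t * X) = c X := by
    intro t ht X
    have : (QuotientGroup.mk ((t : G ⧸ Q) * X) : (G ⧸ Q) ⧸ T.map (QuotientGroup.mk' Q)) =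
        QuotientGroup.mk X := by
      rw [QuotientGroup.mk_mul, (QuotientGroup.eq_one_iff (t : G ⧸ Q)).mpr
        (Subgroup.mem_map_of_mem (QuotientGroup.mk' Q) ht), one_mul]
    simp only [c, this]
  refine ⟨fun g => θ g, fun g => hθ g, fun q hq g => ?_, fun t ht g => ?_⟩
  · have : ((q * g : G) : G ⧸ Q) = g := by
      rw [QuotientGroup.mk_mul, (QuotientGroup.eq_one_iff q).mpr hq, one_mul]
    simp only [this]
  · rw [← QuotientGroup.eq_one_iff]
    simp only [QuotientGroup.mk_mul, QuotientGroup.mk_inv, θ_mk, hcT t ht]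
    group

section Translation

variable {Q T₁ : Subgroup G} [R.Normal] [S.Normal] [T.Normal] {τ : G → G}

theorem TripleSplit.first_of_translation (hc : TripleCentral R S T) {f : G → B}
    (hf : TripleSplit R S T₁ f) (hR : R ≤ Q) (hS : S ≤ Q) (hT₁ : T₁ = T ⊓ Q)
    (τ_mem : ∀ g, τ g ∈ T) (τ_mul : ∀ q ∈ Q, ∀ g, τ (q * g) = τ g)
    (τ_T : ∀ t ∈ T, ∀ g, (τ (t * g))⁻¹ * t * τ g ∈ Q) (r : G) (hr : r ∈ R) :
    SplitSum S T fun g => f ((τ (r * g))⁻¹ * (r * g)) - f ((τ g)⁻¹ * g) := by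
  obtain ⟨x, y, hx, hy, hxy⟩ := hf.first r hr
  let q : G → G := fun g => r⁻¹ * (τ g)⁻¹ * r * τ g
  have q_R : ∀ g, q g ∈ R := fun g => by
    have := mul_mem (inv_mem hr) (Subgroup.Normal.conj_mem' ‹R.Normal› r hr (τ g))
    simpa only [q, mul_assoc] using this
  have q_T : ∀ g, q g ∈ T := fun g =>
    mul_mem (Subgroup.Normal.conj_mem' ‹T.Normal› _ (inv_mem (τ_mem g)) r) (τ_mem g)
  have q_T₁ : ∀ g, q g ∈ T₁ := fun g => hT₁ ▸ Subgroup.mem_inf.mpr ⟨q_T g, hR (q_R g)⟩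
  have q_S : ∀ s ∈ S, ∀ g, q (s * g) = q g := fun s hs g => by
    simp only [q, τ_mul s (hS hs)]
  have k_S : ∀ s ∈ S, ∀ g, ∃ s' ∈ S, (τ (s * g))⁻¹ * (s * g) = s' * ((τ g)⁻¹ * g) :=
    fun s hs g => ⟨(τ g)⁻¹ * s * τ g, Subgroup.Normal.conj_mem' ‹S.Normal› s hs _, by
      rw [τ_mul s (hS hs)]; group⟩
  refine ⟨fun g => x (q g * ((τ g)⁻¹ * g)) + (f (q g * ((τ g)⁻¹ * g)) - f ((τ g)⁻¹ * g)),
    y ∘ fun g => (τ g)⁻¹ * g, fun s hs g => ?_, hy.comp fun t ht g =>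
      ⟨(τ (t * g))⁻¹ * t * τ g, hT₁ ▸ Subgroup.mem_inf.mpr
        ⟨mul_mem (mul_mem (inv_mem (τ_mem _)) ht) (τ_mem g), τ_T t ht g⟩, by group⟩, fun g => ?_⟩
  · obtain ⟨s', hs', e⟩ := k_S s hs g
    have e' : q g * (s' * ((τ g)⁻¹ * g)) = s' * (q g * ((τ g)⁻¹ * g)) := by
      rw [← mul_assoc, hc.second _ (Subgroup.mem_inf.mpr ⟨q_T g, q_R g⟩) s' hs', mul_assoc]
    beta_reduce
    rw [q_S s hs, e, e', hx s' hs']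
    obtain ⟨u, v, hu, hv, huv⟩ := hf.second s' hs'
    have h1 := huv (q g * ((τ g)⁻¹ * g))
    rw [hu _ (q_T₁ g), hv _ (q_R g), ← huv] at h1
    rw [add_right_inj, sub_eq_sub_iff_sub_eq_sub]
    exact h1
  · have h1 := hxy (q g * ((τ g)⁻¹ * g))
    have e : (τ (r * g))⁻¹ * (r * g) = r * (q g * ((τ g)⁻¹ * g)) := by
      rw [τ_mul r (hR hr)]; simp only [q]; group
    rw [hy _ (q_T₁ g)] at h1
    simp only [Function.comp_apply]
    beta_reduce at h1
    rw [e, add_right_comm, ← h1]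
    abel

theorem TripleExtension.exists_enlarge (hc : TripleCentral R S T) {ι f : G → B}
    (hf : TripleExtension R S (T ⊓ (R ⊔ S)) ι f) : ∃ f', TripleExtension R S T ι f' := by
  obtain ⟨τ, τ_mem, τ_mul, τ_T⟩ := exists_translation (R ⊔ S) T
  have hR : R ≤ R ⊔ S := le_sup_left
  have hS : S ≤ R ⊔ S := le_sup_right
  refine ⟨fun g => f ((τ g)⁻¹ * g), ⟨fun t ht => ?_,
    TripleSplit.first_of_translation hc hf.split hR hS rfl τ_mem τ_mul τ_T, fun s hs =>
    (TripleSplit.first_of_translation hc.swap hf.split.swap hS hR rfl τ_mem τ_mul τ_T s hs).symm⟩,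
    fun a ha g => ?_⟩
  · let w : G → G := fun g => (τ (t * g))⁻¹ * t * τ g
    have w_mem : ∀ g, w g ∈ T ⊓ (R ⊔ S) := fun g => Subgroup.mem_inf.mpr
      ⟨mul_mem (mul_mem (inv_mem (τ_mem _)) ht) (τ_mem g), τ_T t ht g⟩
    have w_mul : ∀ q ∈ R ⊔ S, ∀ g, w (q * g) = w g := fun q hq g => by
      have e : t * (q * g) = t * q * t⁻¹ * (t * g) := by group
      simp only [w]
      rw [e, τ_mul _ (Subgroup.Normal.conj_mem inferInstance q hq t), τ_mul q hq]
    choose! x y hx hy hxy using hf.split.third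
    have inv : ∀ (N : Subgroup G) [N.Normal], N ≤ R ⊔ S → ∀ z : G → G → B,
        (∀ t ∈ T ⊓ (R ⊔ S), LeftInvariant N (z t)) →
          LeftInvariant N fun g => z (w g) ((τ g)⁻¹ * g) := by
      intro N hN hNQ z hz n hn g
      have e : (τ g)⁻¹ * (n * g) = (τ g)⁻¹ * n * τ g * ((τ g)⁻¹ * g) := by group
      beta_reduce
      rw [w_mul n (hNQ hn), τ_mul n (hNQ hn), e,
        hz _ (w_mem g) _ (Subgroup.Normal.conj_mem' hN n hn _)]
    refine ⟨_, _, inv R hR x hx, inv S hS y hy, fun g => ?_⟩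
    have e : (τ (t * g))⁻¹ * (t * g) = w g * ((τ g)⁻¹ * g) := by simp only [w]; group
    beta_reduce
    rw [e]
    exact hxy _ (w_mem g) _
  · obtain ⟨haRS, haT⟩ := Subgroup.mem_inf.mp ha
    rw [τ_mul a (hR haRS.1), ← mul_assoc, ← hc.third a haRS _ (inv_mem (τ_mem g)), mul_assoc]
    exact hf.translate a (Subgroup.mem_inf.mpr ⟨haRS, haT, hR haRS.1⟩) _

end Translation

theorem TripleCentral.mono {R' S' T' : Subgroup G} (h : TripleCentral R S T) (hR : R' ≤ R)
    (hS : S' ≤ S) (hT : T' ≤ T) : TripleCentral R' S' T' :=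
  ⟨fun a ha t ht => h.third a (inf_le_inf hR hS ha) t (hT ht),
    fun a ha r hr => h.first a (inf_le_inf hS hT ha) r (hR hr),
    fun a ha s hs => h.second a (inf_le_inf hT hR ha) s (hS hs)⟩

theorem SplitSum.of_subgroupOf {H : Subgroup G} (hR : R ≤ H) (hS : S ≤ H) {F : H → B}
    (hF : SplitSum (R.subgroupOf H) (S.subgroupOf H) F) {k : G → H}
    (hk : ∀ (h : H) (g : G), k (h * g) = h * k g) : SplitSum R S (F ∘ k) := by
  obtain ⟨x, y, hx, hy, hxy⟩ := hF
  exact ⟨x ∘ k, y ∘ k,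
    hx.comp fun r hr g => ⟨⟨r, hR hr⟩, hr, hk ⟨r, hR hr⟩ g⟩,
    hy.comp fun s hs g => ⟨⟨s, hS hs⟩, hs, hk ⟨s, hS hs⟩ g⟩, fun g => hxy (k g)⟩

theorem exists_equivariant_retraction (H : Subgroup G) [H.Normal] :
    ∃ k : G → H, ∀ (h : H) (g : G), k (h * g) = h * k g := by
  have mem : ∀ g : G, g * (g : G ⧸ H).out⁻¹ ∈ H := fun g =>
    (Subgroup.Normal.mem_comm_iff inferInstance).mp (QuotientGroup.eq.mp (QuotientGroup.out_eq' _))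
  refine ⟨fun g => ⟨_, mem g⟩, fun h g => Subtype.ext ?_⟩
  have e : ((h * g : G) : G ⧸ H) = g := by
    rw [QuotientGroup.mk_mul, (QuotientGroup.eq_one_iff _).mpr h.2, one_mul]
  simp only [Subgroup.coe_mul, e, mul_assoc]

variable [R.Normal] [S.Normal] [T.Normal]

theorem TripleCentral.exists_tripleExtension_of_le (hc : TripleCentral R S T)
    (hR : R ≤ S ⊔ T) (hS : S ≤ T ⊔ R) (hT : T ≤ R ⊔ S) (ι : G → DyadicQuotient)
    (hι : ∀ a ∈ R ⊓ S ⊓ T, ∀ b ∈ R ⊓ S ⊓ T, ι (a * b) = ι a + ι b) :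
    ∃ f, TripleExtension R S T ι f := by
  set H := R ⊔ S with hH
  have hRH : R ≤ H := le_sup_left
  have hSH : S ≤ H := le_sup_right
  have top : ∀ {K L : Subgroup G}, K ≤ H → L ≤ H → H ≤ K ⊔ L →
      K.subgroupOf H ⊔ L.subgroupOf H = ⊤ := fun hK hL h => by
    rw [← Subgroup.subgroupOf_sup hK hL, Subgroup.subgroupOf_eq_top]
    exact h
  have hc' : TripleCentral (R.subgroupOf H) (S.subgroupOf H) (T.subgroupOf H) :=
    ⟨fun a ha t ht => Subtype.ext (hc.third a ha t ht),
      fun a ha t ht => Subtype.ext (hc.first a ha t ht),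
      fun a ha t ht => Subtype.ext (hc.second a ha t ht)⟩
  obtain ⟨f, hf, hfι⟩ := hc'.exists_tripleSplit_of_sup_eq_top (top hRH hSH le_rfl)
    (top hRH hT (sup_le le_sup_left (hS.trans (sup_comm T R).le)))
    (top hSH hT (sup_le hR le_sup_left)) (fun h => ι h) fun a ha b hb => hι a ha b hb
  obtain ⟨k, hk⟩ := exists_equivariant_retraction H
  have aux : ∀ {K L : Subgroup G}, K ≤ H → L ≤ H → ∀ n : H,
      SplitSum (K.subgroupOf H) (L.subgroupOf H) (fun g => f (n * g) - f g) →
      SplitSum K L fun g => (f ∘ k) (n * g) - (f ∘ k) g := fun hK hL n h => by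
    have := h.of_subgroupOf hK hL hk
    simpa only [Function.comp_def, hk] using this
  refine ⟨f ∘ k, ⟨fun t ht => aux hRH hSH ⟨t, hT ht⟩ (hf.third _ ht),
    fun r hr => aux hSH hT ⟨r, hRH hr⟩ (hf.first _ hr),
    fun s hs => aux hT hRH ⟨s, hSH hs⟩ (hf.second _ hs)⟩, fun a ha g => ?_⟩
  have := hfι ⟨a, hRH ha.1.1⟩ ha (k g)
  rwa [← hk] at this

theorem TripleCentral.exists_tripleExtension (hc : TripleCentral R S T) (ι : G → DyadicQuotient)
    (hι : ∀ a ∈ R ⊓ S ⊓ T, ∀ b ∈ R ⊓ S ⊓ T, ι (a * b) = ι a + ι b) :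
    ∃ f, TripleExtension R S T ι f := by
  set T₁ := T ⊓ (R ⊔ S) with hT₁
  set R₁ := R ⊓ (S ⊔ T₁) with hR₁
  set S₁ := S ⊓ (T₁ ⊔ R₁) with hS₁
  have le_T : T₁ ≤ T := inf_le_left
  have le_R : R₁ ≤ R := inf_le_left
  have le_S : S₁ ≤ S := inf_le_left
  have hT : T₁ ≤ R₁ ⊔ S₁ := fun t ht => by
    obtain ⟨r, hr, s, hs, rfl⟩ := Subgroup.mem_sup_of_normal_right.mp ht.2
    have hr' : r ∈ R₁ := by
      refine ⟨hr, ?_⟩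
      have := mul_mem (le_sup_right (a := S) ht) (inv_mem (le_sup_left (b := T₁) hs))
      rwa [mul_inv_cancel_right] at this
    refine Subgroup.mul_mem_sup hr' ⟨hs, ?_⟩
    have := mul_mem (inv_mem (le_sup_right (a := T₁) hr')) (le_sup_left (b := R₁) ht)
    rwa [inv_mul_cancel_left] at this
  have hR : R₁ ≤ S₁ ⊔ T₁ := fun r hr => by
    obtain ⟨s, hs, t, ht, rfl⟩ := Subgroup.mem_sup_of_normal_right.mp hr.2
    refine Subgroup.mul_mem_sup ⟨hs, ?_⟩ ht
    have := mul_mem (le_sup_right (a := T₁) hr) (inv_mem (le_sup_left (b := R₁) ht))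
    rwa [mul_inv_cancel_right] at this
  obtain ⟨f, hf⟩ := (hc.mono le_R le_S le_T).exists_tripleExtension_of_le hR inf_le_right hT ι
    fun a ha b hb => hι a (inf_le_inf (inf_le_inf le_R le_S) le_T ha) b
      (inf_le_inf (inf_le_inf le_R le_S) le_T hb)
  obtain ⟨f, hf⟩ := TripleExtension.exists_enlarge
    (hc.rotate.rotate.mono le_T le_R le_rfl) hf.rotate.rotate
  obtain ⟨f, hf⟩ := TripleExtension.exists_enlarge
    (hc.rotate.mono le_rfl le_T le_rfl) hf.rotate.rotate
  exact TripleExtension.exists_enlarge hc hf.rotate.rotate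

end Reduction

/-! ### Functionals on the integral group ring -/

section GroupRing

open MonoidAlgebra
open scoped commutatorElement

variable {G : Type u} [Group G] {B : Type*} [AddCommGroup B] {N R S T : Subgroup G}

/-- The linear extension of a function on the group to the integral group ring. -/
noncomputable def groupRingEval (f : G → B) : MonoidAlgebra ℤ G →ₗ[ℤ] B :=
  Finsupp.linearCombination ℤ f ∘ₗ (MonoidAlgebra.coeffLinearEquiv ℤ).toLinearMap

@[simp]
theorem groupRingEval_of (f : G → B) (g : G) : groupRingEval f (of ℤ G g) = f g := by
  simp [groupRingEval]

@[simp]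
theorem groupRingEval_one (f : G → B) : groupRingEval f 1 = f 1 := by
  rw [← map_one (of ℤ G), groupRingEval_of]

theorem groupRingEval_sub (f f' : G → B) (x : MonoidAlgebra ℤ G) :
    groupRingEval (fun g => f g - f' g) x = groupRingEval f x - groupRingEval f' x := by
  induction x using MonoidAlgebra.induction_on with
  | of g => simp only [groupRingEval_of]
  | add x y hx hy => rw [map_add, map_add, map_add, hx, hy]; abel
  | smul r x hx => rw [map_smul, map_smul, map_smul, hx, smul_sub]

theorem groupRingEval_add (f f' : G → B) (x : MonoidAlgebra ℤ G) :
    groupRingEval (fun g => f g + f' g) x = groupRingEval f x + groupRingEval f' x := by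
  induction x using MonoidAlgebra.induction_on with
  | of g => simp only [groupRingEval_of]
  | add x y hx hy => rw [map_add, map_add, map_add, hx, hy]; abel
  | smul r x hx => rw [map_smul, map_smul, map_smul, hx, smul_add]

theorem groupRingEval_mul_left (f : G → B) (t : G) (x : MonoidAlgebra ℤ G) :
    groupRingEval (fun g => f (t * g)) x = groupRingEval f (of ℤ G t * x) := by
  induction x using MonoidAlgebra.induction_on with
  | of g => rw [← map_mul, groupRingEval_of, groupRingEval_of]
  | add x y hx hy => rw [map_add, mul_add, map_add, hx, hy]
  | smul r x hx => rw [map_smul, mul_smul_comm, map_smul, hx]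

theorem groupRingEval_mul_right (f : G → B) (t : G) (x : MonoidAlgebra ℤ G) :
    groupRingEval (fun g => f (g * t)) x = groupRingEval f (x * of ℤ G t) := by
  induction x using MonoidAlgebra.induction_on with
  | of g => rw [← map_mul, groupRingEval_of, groupRingEval_of]
  | add x y hx hy => rw [map_add, add_mul, map_add, hx, hy]
  | smul r x hx => rw [map_smul, smul_mul_assoc, map_smul, hx]

/-! ### Relative augmentation ideals -/

/-- A submodule of a ring that is closed under multiplication on both sides. -/
def IsTwoSidedSubmodule {A : Type*} [Ring A] (I : Submodule ℤ A) : Prop :=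
  ∀ x ∈ I, ∀ a, a * x ∈ I ∧ x * a ∈ I

namespace IsTwoSidedSubmodule

variable {A : Type*} [Ring A] {I J : Submodule ℤ A}

theorem inf (hI : IsTwoSidedSubmodule I) (hJ : IsTwoSidedSubmodule J) :
    IsTwoSidedSubmodule (I ⊓ J) := fun x hx a =>
  ⟨⟨(hI x hx.1 a).1, (hJ x hx.2 a).1⟩, (hI x hx.1 a).2, (hJ x hx.2 a).2⟩

theorem mul (hI : IsTwoSidedSubmodule I) (hJ : IsTwoSidedSubmodule J) :
    IsTwoSidedSubmodule (I * J) := by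
  intro x hx a
  induction hx using Submodule.mul_induction_on' with
  | mem_mul_mem m hm n hn =>
    exact ⟨by rw [← mul_assoc]; exact Submodule.mul_mem_mul (hI m hm a).1 hn,
      by rw [mul_assoc]; exact Submodule.mul_mem_mul hm (hJ n hn a).2⟩
  | add x _ y _ hx hy =>
    rw [mul_add, add_mul]
    exact ⟨add_mem hx.1 hy.1, add_mem hx.2 hy.2⟩

theorem add (hI : IsTwoSidedSubmodule I) (hJ : IsTwoSidedSubmodule J) :
    IsTwoSidedSubmodule (I + J) := by
  intro x hx a
  obtain ⟨y, hy, z, hz, rfl⟩ := Submodule.mem_sup.mp hx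
  rw [mul_add, add_mul]
  exact ⟨Submodule.add_mem_sup (hI y hy a).1 (hJ z hz a).1,
    Submodule.add_mem_sup (hI y hy a).2 (hJ z hz a).2⟩

end IsTwoSidedSubmodule

theorem isTwoSidedSubmodule_relativeIdeal (N : Subgroup G) :
    IsTwoSidedSubmodule (relativeIdeal N) := by
  intro x hx c
  induction hx using Submodule.span_induction with
  | mem x h =>
    obtain ⟨a, b, r, hr, rfl⟩ := h
    exact ⟨Submodule.subset_span ⟨c * a, b, r, hr, by simp only [mul_assoc]⟩,
      Submodule.subset_span ⟨a, b * c, r, hr, by simp only [mul_assoc]⟩⟩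
  | zero => rw [mul_zero, zero_mul]; exact ⟨zero_mem _, zero_mem _⟩
  | add x y _ _ hx hy =>
    rw [mul_add, add_mul]
    exact ⟨add_mem hx.1 hy.1, add_mem hx.2 hy.2⟩
  | smul r x _ hx =>
    rw [mul_smul_comm, smul_mul_assoc]
    exact ⟨Submodule.smul_mem _ r hx.1, Submodule.smul_mem _ r hx.2⟩

theorem of_sub_one_mem_relativeIdeal {n : G} (hn : n ∈ N) :
    of ℤ G n - 1 ∈ relativeIdeal N :=
  Submodule.subset_span ⟨1, 1, n, hn, by rw [one_mul, mul_one]⟩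

theorem relativeIdeal_le [N.Normal] {P : Submodule ℤ (MonoidAlgebra ℤ G)}
    (h : ∀ n ∈ N, ∀ g, (of ℤ G n - 1) * of ℤ G g ∈ P) : relativeIdeal N ≤ P := by
  have right : ∀ n ∈ N, ∀ b, (of ℤ G n - 1) * b ∈ P := by
    intro n hn b
    induction b using MonoidAlgebra.induction_on with
    | of g => exact h n hn g
    | add x y hx hy => rw [mul_add]; exact add_mem hx hy
    | smul r x hx => rw [mul_smul_comm]; exact P.smul_mem r hx
  refine Submodule.span_le.mpr ?_
  rintro _ ⟨a, b, n, hn, rfl⟩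
  induction a using MonoidAlgebra.induction_on with
  | of g =>
    have : of ℤ G g * (of ℤ G n - 1) * b = (of ℤ G (g * n * g⁻¹) - 1) * (of ℤ G g * b) := by
      rw [← mul_assoc, sub_mul, mul_sub, ← map_mul, ← map_mul, inv_mul_cancel_right, mul_one,
        one_mul]
    rw [this]
    exact right _ (Subgroup.Normal.conj_mem ‹N.Normal› n hn g) _
  | add x y hx hy => rw [add_mul, add_mul]; exact add_mem hx hy
  | smul r x hx => rw [smul_mul_assoc, smul_mul_assoc]; exact P.smul_mem r hx

theorem tripleIdeal_rotate (R S T : Subgroup G) : tripleIdeal S T R = tripleIdeal R S T := by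
  unfold tripleIdeal
  abel

theorem isTwoSidedSubmodule_tripleIdeal (R S T : Subgroup G) :
    IsTwoSidedSubmodule (tripleIdeal R S T) := by
  have h := isTwoSidedSubmodule_relativeIdeal (G := G)
  exact ((((((h R).mul ((h S).inf (h T))).add (((h S).inf (h T)).mul (h R))).add
    ((h S).mul ((h T).inf (h R)))).add (((h T).inf (h R)).mul (h S))).add
    ((h T).mul ((h R).inf (h S)))).add (((h R).inf (h S)).mul (h T))

/-- The triple ideal is contained in a submodule as soon as its three symmetric parts are. -/
theorem tripleIdeal_le {P : Submodule ℤ (MonoidAlgebra ℤ G)}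
    (h₁ : ∀ x ∈ relativeIdeal R, ∀ y ∈ relativeIdeal S ⊓ relativeIdeal T, x * y ∈ P ∧ y * x ∈ P)
    (h₂ : ∀ x ∈ relativeIdeal S, ∀ y ∈ relativeIdeal T ⊓ relativeIdeal R, x * y ∈ P ∧ y * x ∈ P)
    (h₃ : ∀ x ∈ relativeIdeal T, ∀ y ∈ relativeIdeal R ⊓ relativeIdeal S, x * y ∈ P ∧ y * x ∈ P) :
    tripleIdeal R S T ≤ P := by
  unfold tripleIdeal
  simp only [Submodule.add_eq_sup]
  refine sup_le (sup_le (sup_le (sup_le (sup_le ?_ ?_) ?_) ?_) ?_) ?_ <;>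
    refine Submodule.mul_le.mpr fun x hx y hy => ?_
  exacts [(h₁ x hx y hy).1, (h₁ y hy x hx).2, (h₂ x hx y hy).1, (h₂ y hy x hx).2,
    (h₃ x hx y hy).1, (h₃ y hy x hx).2]

theorem mul_mem_tripleIdeal {x y : MonoidAlgebra ℤ G} (hx : x ∈ relativeIdeal T)
    (hy : y ∈ relativeIdeal R ⊓ relativeIdeal S) :
    x * y ∈ tripleIdeal R S T ∧ y * x ∈ tripleIdeal R S T := by
  unfold tripleIdeal
  simp only [Submodule.add_eq_sup]
  exact ⟨Submodule.mem_sup_left (Submodule.mem_sup_right (Submodule.mul_mem_mul hx hy)),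
    Submodule.mem_sup_right (Submodule.mul_mem_mul hy hx)⟩

theorem tripleIdeal_le_relativeIdeal (R S T : Subgroup G) :
    tripleIdeal R S T ≤ relativeIdeal R := by
  have h := isTwoSidedSubmodule_relativeIdeal R
  exact tripleIdeal_le (fun x hx y _ => (h x hx y).symm) (fun x _ y hy => h y hy.2 x)
    (fun x _ y hy => h y hy.1 x)

theorem mapDomain_mem_relativeIdeal {H : Type*} [Group H] (φ : G →* H) {N : Subgroup G}
    {x : MonoidAlgebra ℤ G} (hx : x ∈ relativeIdeal N) :
    mapDomainRingHom ℤ φ x ∈ relativeIdeal (N.map φ) := by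
  induction hx using Submodule.span_induction with
  | mem x h =>
    obtain ⟨a, b, r, hr, rfl⟩ := h
    refine Submodule.subset_span ⟨mapDomainRingHom ℤ φ a, mapDomainRingHom ℤ φ b, φ r,
      Subgroup.mem_map_of_mem φ hr, ?_⟩
    rw [map_mul, map_mul, map_sub, map_one]
    simp
  | zero => rw [map_zero]; exact zero_mem _
  | add x y _ _ hx hy => rw [map_add]; exact add_mem hx hy
  | smul r x _ hx => rw [map_zsmul]; exact Submodule.smul_mem _ r hx

theorem mapDomain_mem_tripleIdeal {H : Type*} [Group H] (φ : G →* H) {x : MonoidAlgebra ℤ G}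
    (hx : x ∈ tripleIdeal R S T) :
    mapDomainRingHom ℤ φ x ∈ tripleIdeal (R.map φ) (S.map φ) (T.map φ) := by
  have key : ∀ {R S T : Subgroup G}, ∀ x ∈ relativeIdeal T,
      ∀ y ∈ relativeIdeal R ⊓ relativeIdeal S,
      mapDomainRingHom ℤ φ (x * y) ∈ tripleIdeal (R.map φ) (S.map φ) (T.map φ) ∧
      mapDomainRingHom ℤ φ (y * x) ∈ tripleIdeal (R.map φ) (S.map φ) (T.map φ) := by
    intro R S T x hx y hy
    rw [map_mul, map_mul]
    exact mul_mem_tripleIdeal (mapDomain_mem_relativeIdeal φ hx)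
      ⟨mapDomain_mem_relativeIdeal φ hy.1, mapDomain_mem_relativeIdeal φ hy.2⟩
  let P : Submodule ℤ (MonoidAlgebra ℤ G) :=
    (tripleIdeal (R.map φ) (S.map φ) (T.map φ)).comap
      (mapDomainRingHom ℤ φ).toAddMonoidHom.toIntLinearMap
  refine tripleIdeal_le (P := P) (fun x hx y hy => ?_) (fun x hx y hy => ?_) key hx
  · have := key x hx y hy
    rwa [tripleIdeal_rotate] at this
  · have := key x hx y hy
    rwa [← tripleIdeal_rotate] at this

/-! ### Functionals vanishing on products -/

theorem LeftInvariant.groupRingEval_eq_zero [R.Normal] {F : G → B} (hF : LeftInvariant R F)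
    {x : MonoidAlgebra ℤ G} (hx : x ∈ relativeIdeal R) : groupRingEval F x = 0 := by
  refine relativeIdeal_le (P := LinearMap.ker (groupRingEval F)) (fun r hr g => ?_) hx
  rw [LinearMap.mem_ker, sub_mul, one_mul, ← map_mul, map_sub, groupRingEval_of, groupRingEval_of,
    hF r hr, sub_self]

theorem SplitSum.groupRingEval_eq_zero [R.Normal] [S.Normal] {F : G → B} (hF : SplitSum R S F)
    {x : MonoidAlgebra ℤ G} (hx : x ∈ relativeIdeal R ⊓ relativeIdeal S) :
    groupRingEval F x = 0 := by
  obtain ⟨u, v, hu, hv, huv⟩ := hF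
  rw [funext huv, groupRingEval_add, hu.groupRingEval_eq_zero hx.1, hv.groupRingEval_eq_zero hx.2,
    add_zero]

theorem mem_of_sub_one_mem_relativeIdeal [R.Normal] {g : G}
    (hg : of ℤ G g - 1 ∈ relativeIdeal R) : g ∈ R := by
  classical
  by_contra h
  let F : G → ℤ := fun x => if x ∈ R then 1 else 0
  have hF : LeftInvariant R F := fun r hr x => by
    simp only [F, Subgroup.mul_mem_cancel_left R hr]
  have := hF.groupRingEval_eq_zero hg
  rw [map_sub, groupRingEval_of, groupRingEval_one] at this
  simp [F, h, one_mem] at this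

theorem SplitSum.of_second_difference [R.Normal] [S.Normal] {F : G → B}
    (hW : LeftInvariant (R ⊓ S) F)
    (hF : ∀ r ∈ R, ∀ s ∈ S, ∀ g, F (r * (s * g)) - F (s * g) = F (r * g) - F g) :
    SplitSum R S F := by
  obtain ⟨k, hk⟩ := exists_equivariant_retraction (R ⊔ S)
  have hdec : ∀ h : ↥(R ⊔ S), ∃ r ∈ R, ∃ s ∈ S, r * s = h := fun h =>
    Subgroup.mem_sup_of_normal_right.mp h.2
  choose ρ hρ σ hσ ρσ using hdec
  let y : G → G := fun g => (k g : G)⁻¹ * g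
  have hy : ∀ h ∈ R ⊔ S, ∀ g, y (h * g) = y g := fun h hh g => by
    simp only [y, hk ⟨h, hh⟩ g, Subgroup.coe_mul]
    group
  have hg : ∀ g, ρ (k g) * (σ (k g) * y g) = g := fun g => by
    rw [← mul_assoc, ρσ, mul_inv_cancel_left]
  have hR : R ≤ R ⊔ S := le_sup_left
  have hS : S ≤ R ⊔ S := le_sup_right
  refine ⟨fun g => F (σ (k g) * y g) - F (y g), fun g => F (ρ (k g) * y g), fun r hr g => ?_,
    fun s hs g => ?_, fun g => ?_⟩
  · have e : ρ (k (r * g)) * σ (k (r * g)) = r * (ρ (k g) * σ (k g)) := by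
      rw [ρσ, ρσ, hk ⟨r, hR hr⟩ g, Subgroup.coe_mul]
    have e' : σ (k (r * g)) * (σ (k g))⁻¹ = (ρ (k (r * g)))⁻¹ * r * ρ (k g) := by
      rw [mul_inv_eq_iff_eq_mul, mul_assoc, mul_assoc, eq_inv_mul_iff_mul_eq, e]
    have hw : σ (k (r * g)) * (σ (k g))⁻¹ ∈ R ⊓ S :=
      Subgroup.mem_inf.mpr ⟨e' ▸ mul_mem (mul_mem (inv_mem (hρ _)) hr) (hρ _),
        mul_mem (hσ _) (inv_mem (hσ _))⟩
    have := hW _ hw (σ (k g) * y g)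
    rw [← mul_assoc, inv_mul_cancel_right] at this
    beta_reduce
    rw [hy r (hR hr), this]
  · have e : ρ (k (s * g)) * σ (k (s * g)) = s * (ρ (k g) * σ (k g)) := by
      rw [ρσ, ρσ, hk ⟨s, hS hs⟩ g, Subgroup.coe_mul]
    have e' : ρ (k (s * g)) * (ρ (k g))⁻¹ =
        s * (ρ (k g) * (σ (k g) * (σ (k (s * g)))⁻¹) * (ρ (k g))⁻¹) := by
      rw [← mul_assoc (ρ (k g)), ← mul_assoc s, ← mul_assoc s, ← e]
      group
    have hw : ρ (k (s * g)) * (ρ (k g))⁻¹ ∈ R ⊓ S :=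
      Subgroup.mem_inf.mpr ⟨mul_mem (hρ _) (inv_mem (hρ _)), e' ▸ mul_mem hs
        (Subgroup.Normal.conj_mem ‹S.Normal› _ (mul_mem (hσ _) (inv_mem (hσ _))) _)⟩
    have := hW _ hw (ρ (k g) * y g)
    rw [← mul_assoc, inv_mul_cancel_right] at this
    beta_reduce
    rw [hy s (hS hs), this]
  · have h := hF _ (hρ (k g)) _ (hσ (k g)) (y g)
    rw [hg, sub_eq_iff_eq_add] at h
    beta_reduce
    rw [h]
    abel

theorem TripleSplit.splitSum_mul_right [R.Normal] [S.Normal] [T.Normal] (hc : TripleCentral R S T)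
    {f : G → B} (hf : TripleSplit R S T f) {t : G} (ht : t ∈ T) (h : G) :
    SplitSum R S fun k => f (k * (t * h)) - f (k * h) := by
  have conj : ∀ k : G, k * (t * h) = k * t * k⁻¹ * (k * h) := fun k => by group
  have hT : ∀ k : G, k * t * k⁻¹ ∈ T := Subgroup.Normal.conj_mem ‹T.Normal› t ht
  refine SplitSum.of_second_difference (fun w hw k => ?_) fun r hr s hs k => ?_
  · obtain ⟨x, y, hx, hy, hxy⟩ := hf.third _ (hT k)
    have h1 := hxy (w * (k * h))
    rw [hx w hw.1, hy w hw.2, ← hxy] at h1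
    beta_reduce at h1 ⊢
    rw [mul_assoc, mul_assoc, conj k, ← mul_assoc w, hc.third w hw _ (hT k), mul_assoc]
    exact h1
  · obtain ⟨x, y, hx, hy, hxy⟩ := hf.first r hr
    have key : ∀ k, f (r * k * (t * h)) - f (r * k * h) - (f (k * (t * h)) - f (k * h)) =
        x (k * (t * h)) - x (k * h) := fun k => by
      have h1 := hxy (k * (t * h))
      have h2 := hxy (k * h)
      have h3 := hy _ (hT k) (k * h)
      rw [← conj] at h3
      rw [h3] at h1
      beta_reduce at h1 h2
      rw [mul_assoc, mul_assoc, sub_sub_sub_comm, h1, h2, add_sub_add_right_eq_sub]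
    rw [key, key, mul_assoc, mul_assoc, hx s hs, hx s hs]

theorem TripleSplit.groupRingEval_mul_eq_zero [R.Normal] [S.Normal] [T.Normal]
    (hc : TripleCentral R S T) {f : G → B} (hf : TripleSplit R S T f) {x y : MonoidAlgebra ℤ G}
    (hx : x ∈ relativeIdeal T) (hy : y ∈ relativeIdeal R ⊓ relativeIdeal S) :
    groupRingEval f (x * y) = 0 ∧ groupRingEval f (y * x) = 0 := by
  constructor
  · refine relativeIdeal_le (N := T) (P := LinearMap.ker
      (groupRingEval f ∘ₗ LinearMap.mulRight ℤ y)) (fun t ht g => ?_) hx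
    have h := (hf.third t ht).groupRingEval_eq_zero
      (((isTwoSidedSubmodule_relativeIdeal R).inf (isTwoSidedSubmodule_relativeIdeal S)
        y hy (of ℤ G g)).1)
    rw [groupRingEval_sub, groupRingEval_mul_left, ← map_sub] at h
    rw [LinearMap.mem_ker, LinearMap.comp_apply, LinearMap.mulRight_apply, ← h, sub_mul, sub_mul,
      one_mul, mul_assoc]
  · refine relativeIdeal_le (N := T) (P := LinearMap.ker
      (groupRingEval f ∘ₗ LinearMap.mulLeft ℤ y)) (fun t ht g => ?_) hx
    have h := (hf.splitSum_mul_right hc ht g).groupRingEval_eq_zero hy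
    rw [groupRingEval_sub, groupRingEval_mul_right, groupRingEval_mul_right, ← map_sub] at h
    rw [LinearMap.mem_ker, LinearMap.comp_apply, LinearMap.mulLeft_apply, ← h, sub_mul, mul_sub,
      one_mul, map_mul]

theorem TripleSplit.groupRingEval_eq_zero [R.Normal] [S.Normal] [T.Normal]
    (hc : TripleCentral R S T) {f : G → B} (hf : TripleSplit R S T f) {x : MonoidAlgebra ℤ G}
    (hx : x ∈ tripleIdeal R S T) : groupRingEval f x = 0 :=
  tripleIdeal_le (P := LinearMap.ker (groupRingEval f))
    (fun _ hx _ hy => hf.rotate.groupRingEval_mul_eq_zero hc.rotate hx hy)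
    (fun _ hx _ hy => hf.rotate.rotate.groupRingEval_mul_eq_zero hc.rotate.rotate hx hy)
    (fun _ hx _ hy => hf.groupRingEval_mul_eq_zero hc hx hy) hx

/-! ### The dimension subgroup of the triple ideal -/

/-- The elements `g` such that `g - 1` lies in the triple ideal. -/
noncomputable def tripleDimension (R S T : Subgroup G) : Subgroup G where
  carrier := {g | of ℤ G g - 1 ∈ tripleIdeal R S T}
  one_mem' := by
    rw [Set.mem_ofPred_eq, map_one, sub_self]
    exact zero_mem _
  mul_mem' := fun {g h} hg hh => by
    have e : of ℤ G (g * h) - 1 = (of ℤ G g - 1) * of ℤ G h + (of ℤ G h - 1) := by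
      rw [map_mul, sub_mul, one_mul, sub_add_sub_cancel]
    rw [Set.mem_ofPred_eq, e]
    exact add_mem (isTwoSidedSubmodule_tripleIdeal R S T _ hg _).2 hh
  inv_mem' := fun {g} hg => by
    have e : of ℤ G g⁻¹ - 1 = -(of ℤ G g⁻¹ * (of ℤ G g - 1)) := by
      rw [mul_sub, ← map_mul, inv_mul_cancel, map_one, mul_one, neg_sub]
    rw [Set.mem_ofPred_eq, e]
    exact neg_mem (isTwoSidedSubmodule_tripleIdeal R S T _ hg _).1

theorem mem_tripleDimension {g : G} :
    g ∈ tripleDimension R S T ↔ of ℤ G g - 1 ∈ tripleIdeal R S T :=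
  Iff.rfl

theorem tripleDimension_normal (R S T : Subgroup G) : (tripleDimension R S T).Normal := by
  refine ⟨fun g hg h => ?_⟩
  have e : of ℤ G (h * g * h⁻¹) - 1 = of ℤ G h * (of ℤ G g - 1) * of ℤ G h⁻¹ := by
    rw [mul_sub, sub_mul, ← map_mul, ← map_mul, mul_one, ← map_mul, mul_inv_cancel, map_one]
  have hJ := isTwoSidedSubmodule_tripleIdeal R S T
  rw [mem_tripleDimension, e]
  exact (hJ _ (hJ _ hg _).1 _).2

theorem tripleDimension_rotate (R S T : Subgroup G) :
    tripleDimension S T R = tripleDimension R S T := by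
  ext g
  rw [mem_tripleDimension, mem_tripleDimension, tripleIdeal_rotate]

theorem commutator_le_tripleDimension (R S T : Subgroup G) :
    ⁅R ⊓ S, T⁆ ≤ tripleDimension R S T := by
  refine Subgroup.commutator_le.mpr fun a ha t ht => ?_
  have e : of ℤ G ⁅a, t⁆ - 1 = ((of ℤ G a - 1) * (of ℤ G t - 1) -
      (of ℤ G t - 1) * (of ℤ G a - 1)) * of ℤ G (a⁻¹ * t⁻¹) := by
    have e1 : (of ℤ G a - 1) * (of ℤ G t - 1) - (of ℤ G t - 1) * (of ℤ G a - 1) =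
        of ℤ G a * of ℤ G t - of ℤ G t * of ℤ G a := by
      simp only [sub_mul, mul_sub, one_mul, mul_one]
      abel
    have e2 : t * a * (a⁻¹ * t⁻¹) = 1 := by group
    rw [e1, sub_mul, ← map_mul, ← map_mul, ← map_mul, ← map_mul, e2, map_one, commutatorElement_def,
      mul_assoc (a * t)]
  have h := mul_mem_tripleIdeal (of_sub_one_mem_relativeIdeal ht)
    ⟨of_sub_one_mem_relativeIdeal ha.1, of_sub_one_mem_relativeIdeal ha.2⟩
  rw [mem_tripleDimension, e]
  exact (isTwoSidedSubmodule_tripleIdeal R S T _ (sub_mem h.2 h.1) _).2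

theorem tripleCommutator_le_tripleDimension (R S T : Subgroup G) :
    tripleCommutator R S T ≤ tripleDimension R S T := by
  refine sup_le (sup_le (commutator_le_tripleDimension R S T) ?_) ?_
  · exact (commutator_le_tripleDimension S T R).trans (tripleDimension_rotate R S T).le
  · exact (commutator_le_tripleDimension T R S).trans (tripleDimension_rotate T R S).ge

theorem tripleDimension_le [R.Normal] [S.Normal] [T.Normal] :
    tripleDimension R S T ≤ R ⊓ S ⊓ T := by
  intro g hg
  refine ⟨⟨mem_of_sub_one_mem_relativeIdeal (tripleIdeal_le_relativeIdeal R S T hg), ?_⟩, ?_⟩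
  · rw [← tripleDimension_rotate] at hg
    exact mem_of_sub_one_mem_relativeIdeal (tripleIdeal_le_relativeIdeal S T R hg)
  · rw [tripleDimension_rotate T R S] at hg
    exact mem_of_sub_one_mem_relativeIdeal (tripleIdeal_le_relativeIdeal T R S hg)

theorem tripleCentral_map_tripleCommutator [R.Normal] [S.Normal] [T.Normal]
    [(tripleCommutator R S T).Normal] :
    TripleCentral (R.map (QuotientGroup.mk' (tripleCommutator R S T)))
      (S.map (QuotientGroup.mk' (tripleCommutator R S T)))
      (T.map (QuotientGroup.mk' (tripleCommutator R S T))) := by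
  have hN : tripleCommutator R S T ≤ R ⊓ S ⊓ T :=
    (tripleCommutator_le_tripleDimension R S T).trans tripleDimension_le
  have key : ∀ K L M : Subgroup G, tripleCommutator R S T ≤ L →
      ⁅K ⊓ L, M⁆ ≤ tripleCommutator R S T →
      ∀ a ∈ K.map (QuotientGroup.mk' (tripleCommutator R S T)) ⊓
        L.map (QuotientGroup.mk' (tripleCommutator R S T)),
      ∀ m ∈ M.map (QuotientGroup.mk' (tripleCommutator R S T)), a * m = m * a := by
    rintro K L M hL h _ ⟨⟨a, ha, rfl⟩, b, hb, hab⟩ _ ⟨m, hm, rfl⟩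
    have haL : a ∈ L := by
      have h1 : b⁻¹ * a ∈ L := hL (QuotientGroup.eq.mp hab)
      exact (Subgroup.mul_mem_cancel_left L (inv_mem hb)).mp h1
    rw [← commutatorElement_eq_one_iff_mul_comm, ← map_commutatorElement]
    exact (QuotientGroup.eq_one_iff _).mpr (h (Subgroup.commutator_mem_commutator ⟨ha, haL⟩ hm))
  exact ⟨key R S T (hN.trans (inf_le_left.trans inf_le_right)) (le_sup_left.trans le_sup_left),
    key S T R (hN.trans inf_le_right) (le_sup_right.trans le_sup_left),
    key T R S (hN.trans (inf_le_left.trans inf_le_left)) le_sup_right⟩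

open Classical in
/-- Homomorphisms on the central intersection detect elements not of `2`-power order. -/
theorem TripleCentral.exists_dyadic_detecting [R.Normal] [S.Normal] [T.Normal]
    (hc : TripleCentral R S T) {g : G} (hg : g ∈ R ⊓ S ⊓ T) (hk : ∀ k : ℕ, g ^ 2 ^ k ≠ 1) :
    ∃ ι : G → DyadicQuotient,
      (∀ a ∈ R ⊓ S ⊓ T, ∀ b ∈ R ⊓ S ⊓ T, ι (a * b) = ι a + ι b) ∧ ι g ≠ 0 := by
  let _ : CommGroup ↥(R ⊓ S ⊓ T) :=
    { (inferInstance : Group ↥(R ⊓ S ⊓ T)) with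
      mul_comm := fun a b => Subtype.ext (hc.third a a.2.1 b b.2.2) }
  obtain ⟨φ, hφ⟩ := DyadicQuotient.exists_character (A := Additive ↥(R ⊓ S ⊓ T))
    (Additive.ofMul ⟨g, hg⟩) fun k h => hk k (congrArg Subtype.val (Additive.ofMul.injective h))
  refine ⟨fun x => if hx : x ∈ R ⊓ S ⊓ T then φ (Additive.ofMul ⟨x, hx⟩) else 0,
    fun a ha b hb => ?_, by simpa only [dif_pos hg] using hφ⟩
  simp only [dif_pos ha, dif_pos hb, dif_pos (mul_mem ha hb)]
  exact φ.map_add (Additive.ofMul ⟨a, ha⟩) (Additive.ofMul ⟨b, hb⟩)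

theorem TripleCentral.exists_pow_eq_one [R.Normal] [S.Normal] [T.Normal]
    (hc : TripleCentral R S T) {g : G} (hg : g ∈ tripleDimension R S T) :
    ∃ k : ℕ, g ^ 2 ^ k = 1 := by
  by_contra! hk
  have hgA := tripleDimension_le hg
  obtain ⟨ι, hι, hιg⟩ := hc.exists_dyadic_detecting hgA hk
  obtain ⟨f, hf⟩ := hc.exists_tripleExtension ι hι
  have h := hf.split.groupRingEval_eq_zero hc hg
  have h1 := hf.translate g hgA 1
  rw [map_sub, groupRingEval_of, groupRingEval_one] at h
  rw [mul_one] at h1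
  exact hιg (by rw [← h, h1, add_sub_cancel_right])

theorem exists_pow_mem_tripleCommutator [R.Normal] [S.Normal] [T.Normal] {g : G}
    (hg : g ∈ tripleDimension R S T) : ∃ k : ℕ, g ^ 2 ^ k ∈ tripleCommutator R S T := by
  have hN : (tripleCommutator R S T).Normal := by
    unfold tripleCommutator
    infer_instance
  let π := QuotientGroup.mk' (tripleCommutator R S T)
  have hπ : Function.Surjective π := QuotientGroup.mk'_surjective _
  have _ : (R.map π).Normal := Subgroup.Normal.map inferInstance π hπ
  have _ : (S.map π).Normal := Subgroup.Normal.map inferInstance π hπ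
  have _ : (T.map π).Normal := Subgroup.Normal.map inferInstance π hπ
  have h := mapDomain_mem_tripleIdeal π hg
  have e : mapDomainRingHom ℤ π (of ℤ G g - 1) = of ℤ _ (π g) - 1 := by
    rw [map_sub, map_one]
    simp
  rw [e] at h
  obtain ⟨k, hk⟩ := tripleCentral_map_tripleCommutator.exists_pow_eq_one (mem_tripleDimension.mpr h)
  refine ⟨k, ?_⟩
  rw [← map_pow] at hk
  exact (QuotientGroup.eq_one_iff _).mp hk

theorem cmt_mem_tripleCommutator [R.Normal] [S.Normal] [T.Normal] {g h : G}
    (hg : g ∈ tripleDimension R S T) (hh : h ∈ tripleDimension R S T) :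
    cmt g h ∈ tripleCommutator R S T := by
  have e : cmt g h = ⁅g⁻¹, h⁻¹⁆ := by rw [cmt, commutatorElement_def, inv_inv, inv_inv]
  rw [e]
  exact Subgroup.mem_sup_left (Subgroup.mem_sup_left (Subgroup.commutator_mem_commutator
    (inv_mem (tripleDimension_le hg).1) (inv_mem (tripleDimension_le hh).2)))

end GroupRing

theorem dimension_quotient_of_triple_ideal_is_abelian_two_torsion
    (G : Type*) [Group G] (R S T : Subgroup G) [R.Normal] [S.Normal] [T.Normal] :
    ∃ D : Subgroup G, D.Normal ∧
      (∀ g : G, g ∈ D ↔ MonoidAlgebra.of ℤ G g - 1 ∈ tripleIdeal R S T) ∧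
      tripleCommutator R S T ≤ D ∧
      (∀ g ∈ D, ∀ h ∈ D, cmt g h ∈ tripleCommutator R S T) ∧
      (∀ g ∈ D, ∃ k : ℕ, g ^ (2 ^ k) ∈ tripleCommutator R S T) :=
  ⟨tripleDimension R S T, tripleDimension_normal R S T, fun _ => mem_tripleDimension,
    tripleCommutator_le_tripleDimension R S T, fun _ hg _ hh => cmt_mem_tripleCommutator hg hh,
    fun _ hg => exists_pow_mem_tripleCommutator hg⟩
end

section
/- Let F be a free group and R, S normal subgroups of F. Then [R,R] ∩ [S,S] ⊆ [R,S]. -/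
/-!
STATEMENT 11. For a free group `F` and normal subgroups `R, S` of `F`:
`[R,R] ∩ [S,S] ⊆ [R,S]`.
-/

open QuotientGroup in
/-- If `T` is a free subgroup contained in the product of `R` and `S`, with `R` normal, then the
projection `T → F ⧸ R` factors through `S`. -/
theorem Subgroup.exists_monoidHom_mk_eq_of_le_sup {F : Type*} [Group F] (R S T : Subgroup F)
    [R.Normal] [IsFreeGroup T] (hT : T ≤ R ⊔ S) :
    ∃ φ : T →* S, ∀ t : T, (mk' R (φ t) : F ⧸ R) = mk' R t := by
  have hex : ∀ t : T, ∃ s : S, (mk' R s : F ⧸ R) = mk' R t := fun t ↦ by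
    obtain ⟨r, hr, s, hs, h⟩ := Subgroup.mem_sup_of_normal_left.mp (hT t.2)
    refine ⟨⟨s, hs⟩, ?_⟩
    rw [← h, map_mul, show mk' R r = 1 from (QuotientGroup.eq_one_iff r).mpr hr, one_mul]
  choose f hf using hex
  refine ⟨IsFreeGroup.lift fun a ↦ f (IsFreeGroup.of a), fun t ↦ ?_⟩
  have key : ((mk' R).comp S.subtype).comp (IsFreeGroup.lift fun a ↦ f (IsFreeGroup.of a)) =
      (mk' R).comp T.subtype :=
    IsFreeGroup.ext_hom fun a ↦ by simpa using hf (IsFreeGroup.of a)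
  exact DFunLike.congr_fun key t

open QuotientGroup commutatorElement in
/-- If `T` contains `R` and `S` and the projection `T → F ⧸ R` factors through `S`, then
`[R,R] ∩ [S,S] ⊆ [R,S]`.
Modulo `[R,S]`, the map `φ` kills `[R,R]` and fixes `[S,S]` pointwise. -/
theorem Subgroup.commutator_inf_commutator_le_of_monoidHom {F : Type*} [Group F]
    (R S T : Subgroup F) [R.Normal] [S.Normal] (hRT : R ≤ T) (hST : S ≤ T) (φ : T →* S)
    (hφ : ∀ t, (mk' R (φ t) : F ⧸ R) = mk' R t) : ⁅R, R⁆ ⊓ ⁅S, S⁆ ≤ ⁅R, S⁆ := by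
  let ρ := mk' ⁅R, S⁆
  let ψ : T →* F ⧸ ⁅R, S⁆ := ρ.comp (S.subtype.comp φ)
  have hcomm : ∀ r ∈ R, ∀ s ∈ S, Commute (ρ r) (ρ s) := fun r hr s hs ↦ by
    rw [← commutatorElement_eq_one_iff_commute, ← map_commutatorElement]
    exact (QuotientGroup.eq_one_iff _).mpr (commutator_mem_commutator hr hs)
  have hR : ⁅R.subgroupOf T, R.subgroupOf T⁆ ≤ ψ.ker := by
    have hmem : ∀ t ∈ R.subgroupOf T, (φ t : F) ∈ R := fun t ht ↦ by
      rw [← QuotientGroup.eq_one_iff]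
      exact (hφ t).trans ((QuotientGroup.eq_one_iff _).mpr (mem_subgroupOf.mp ht))
    rw [commutator_le]
    intro a ha b hb
    rw [MonoidHom.mem_ker, map_commutatorElement, commutatorElement_eq_one_iff_commute]
    exact hcomm _ (hmem a ha) _ (φ b).2
  have hS : ⁅S.subgroupOf T, S.subgroupOf T⁆ ≤ ψ.eqLocus (ρ.comp T.subtype) := by
    have hdiv : ∀ t ∈ S.subgroupOf T, ∃ q ∈ R, q ∈ S ∧ (φ t : F) = t * q := fun t ht ↦
      ⟨(t : F)⁻¹ * φ t, QuotientGroup.eq.mp (hφ t).symm,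
        S.mul_mem (S.inv_mem (mem_subgroupOf.mp ht)) (φ t).2, by group⟩
    rw [commutator_le]
    intro a ha b hb
    obtain ⟨p, hpR, -, hp⟩ := hdiv a ha
    obtain ⟨q, hqR, hqS, hq⟩ := hdiv b hb
    have hpb := hcomm p hpR b hb
    have hqa := hcomm q hqR a ha
    have hpq := hcomm p hpR q hqS
    change ψ ⁅a, b⁆ = ρ.comp T.subtype ⁅a, b⁆
    simp only [map_commutatorElement]
    change ⁅ρ (φ a), ρ (φ b)⁆ = ⁅ρ a, ρ b⁆
    rw [hp, hq, map_mul, map_mul]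
    have hp' : Commute (ρ p) (ρ b * ρ q) := hpb.mul_right hpq
    generalize ρ a = a', ρ b = b', ρ p = p', ρ q = q' at *
    rw [commutatorElement_def, commutatorElement_def, mul_inv_rev, mul_assoc a', hp'.eq,
      mul_inv_rev, ← mul_assoc a', mul_assoc (a' * _) p', mul_inv_cancel_left,
      ← mul_assoc a', mul_assoc (a' * b') q', hqa.inv_right.eq]
    group
  rintro x ⟨hxR, hxS⟩
  have hxT : x ∈ T := hRT (commutator_le_left R R hxR)
  have lift_mem : ∀ H : Subgroup F, H ≤ T → x ∈ ⁅H, H⁆ →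
      (⟨x, hxT⟩ : T) ∈ ⁅H.subgroupOf T, H.subgroupOf T⁆ := fun H hH hx ↦ by
    rw [← map_subgroupOf_eq_of_le hH, ← map_commutator] at hx
    obtain ⟨y, hy, rfl⟩ := hx
    exact hy
  rw [← QuotientGroup.eq_one_iff]
  have h1 : ψ ⟨x, hxT⟩ = 1 := hR (lift_mem R hRT hxR)
  have h2 : ψ ⟨x, hxT⟩ = ρ x := hS (lift_mem S hST hxS)
  exact h2.symm.trans h1

theorem commutator_inter_commutator_le_commutator
    (α : Type*) (R S : Subgroup (FreeGroup α)) [R.Normal] [S.Normal] :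
    (⁅R, R⁆ : Subgroup (FreeGroup α)) ⊓ ⁅S, S⁆ ≤ ⁅R, S⁆ := by
  obtain ⟨φ, hφ⟩ := Subgroup.exists_monoidHom_mk_eq_of_le_sup R S (R ⊔ S) le_rfl
  exact Subgroup.commutator_inf_commutator_le_of_monoidHom R S _ le_sup_left le_sup_right φ hφ
end

section
/- Let G be a group and R, S, T normal subgroups of G. Then there are group isomorphisms (RS ∩ RT)/(R(S∩T)) ≅ (SR ∩ ST)/(S(R∩T)) ≅ (TR ∩ TS)/(T(R∩S)). -/
/-!
STATEMENT 12. For a group `G` with normal subgroups `R, S, T`, there are group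
isomorphisms
`(RS ∩ RT)/(R(S∩T)) ≅ (SR ∩ ST)/(S(R∩T)) ≅ (TR ∩ TS)/(T(R∩S))`.
For normal subgroups the product subgroup `AB` is the join `A ⊔ B`.
-/

/-- A normal subgroup of `G` is normal in any subgroup of `G` it is intersected into. -/
instance subgroupOf_normal {G : Type*} [Group G] (H K : Subgroup G) [hH : H.Normal] :
    (H.subgroupOf K).Normal :=
  hH.subgroupOf K

namespace Subgroup

variable {G : Type*} [Group G]

/-- Second isomorphism theorem, applied twice: two quotients that are both covered by the same
subgroup `A`, with the same kernel, are isomorphic. -/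
theorem nonempty_quotient_mulEquiv_of_common_cover {A K N K' N' : Subgroup G}
    [N.Normal] [N'.Normal] (hAK : A ≤ K) (hK : K ≤ N ⊔ A) (hNK : N ≤ K)
    (hAK' : A ≤ K') (hK' : K' ≤ N' ⊔ A) (hNK' : N' ≤ K') (h : A ⊓ N = A ⊓ N') :
    Nonempty ((K ⧸ N.subgroupOf K) ≃* (K' ⧸ N'.subgroupOf K')) := by
  have cover : ∀ {K N : Subgroup G} [N.Normal], A ≤ K → K ≤ N ⊔ A → N ≤ K →
      Nonempty ((A ⧸ N.subgroupOf A) ≃* (K ⧸ N.subgroupOf K)) := by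
    intro K N _ hAK hK hNK
    obtain rfl : K = A ⊔ N := le_antisymm (hK.trans_eq (sup_comm N A)) (sup_le hAK hNK)
    exact ⟨QuotientGroup.quotientInfEquivProdNormalQuotient A N⟩
  obtain ⟨e⟩ := cover hAK hK hNK
  obtain ⟨e'⟩ := cover hAK' hK' hNK'
  have hN : N.subgroupOf A = N'.subgroupOf A := by
    rw [← inf_subgroupOf_left, h, inf_subgroupOf_left]
  exact ⟨e.symm.trans ((QuotientGroup.quotientMulEquivOfEq hN).trans e')⟩

/-- For `R` normal, `RS ∩ RT` is covered by `T ∩ RS` modulo `R`. -/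
theorem sup_inf_sup_le_sup_inf (R S T : Subgroup G) [R.Normal] :
    (R ⊔ S) ⊓ (R ⊔ T) ≤ R ⊔ T ⊓ (R ⊔ S) := by
  rintro x ⟨hS, hT⟩
  obtain ⟨r, hr, t, ht, rfl⟩ := mem_sup_of_normal_left.mp hT
  exact mul_mem_sup hr ⟨ht, (mul_mem_cancel_left (le_sup_left (a := R) (b := S) hr)).mp hS⟩

theorem inf_sup_inf_le (R S T : Subgroup G) [R.Normal] :
    T ⊓ (R ⊔ T ⊓ S) ≤ T ⊓ R ⊔ T ⊓ S := by
  rintro x ⟨hT, hx⟩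
  obtain ⟨r, hr, y, hy, rfl⟩ := mem_sup_of_normal_left.mp hx
  exact mul_mem_sup ⟨(Subgroup.mul_mem_cancel_right T hy.1).mp hT, hr⟩ hy

theorem nonempty_sup_inf_sup_quotient_mulEquiv (R S T : Subgroup G)
    [R.Normal] [S.Normal] [T.Normal] :
    Nonempty
      ((((R ⊔ S) ⊓ (R ⊔ T) : Subgroup G) ⧸ (R ⊔ S ⊓ T).subgroupOf ((R ⊔ S) ⊓ (R ⊔ T))) ≃*
       (((S ⊔ R) ⊓ (S ⊔ T) : Subgroup G) ⧸ (S ⊔ R ⊓ T).subgroupOf ((S ⊔ R) ⊓ (S ⊔ T)))) := by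
  have kernel_le : ∀ (R S : Subgroup G) [R.Normal],
      T ⊓ (R ⊔ S) ⊓ (R ⊔ S ⊓ T) ≤ T ⊓ (R ⊔ S) ⊓ (S ⊔ R ⊓ T) := by
    intro R S _
    refine le_inf inf_le_left ?_
    calc T ⊓ (R ⊔ S) ⊓ (R ⊔ S ⊓ T) ≤ T ⊓ (R ⊔ T ⊓ S) := by
          rw [inf_comm S T]; exact inf_le_inf_right _ inf_le_left
      _ ≤ T ⊓ R ⊔ T ⊓ S := inf_sup_inf_le R S T
      _ ≤ S ⊔ R ⊓ T := by
          rw [sup_comm, inf_comm T R]; exact sup_le_sup_right inf_le_right _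
  have cover_le : ∀ R S : Subgroup G, T ⊓ (R ⊔ S) ≤ (R ⊔ S) ⊓ (R ⊔ T) := fun _ _ =>
    le_inf inf_le_right (inf_le_left.trans le_sup_right)
  have le_cover : ∀ (R S : Subgroup G) [R.Normal],
      (R ⊔ S) ⊓ (R ⊔ T) ≤ R ⊔ S ⊓ T ⊔ T ⊓ (R ⊔ S) := fun R S _ =>
    (sup_inf_sup_le_sup_inf R S T).trans (sup_le_sup_right le_sup_left _)
  refine nonempty_quotient_mulEquiv_of_common_cover (A := T ⊓ (R ⊔ S))
    (cover_le R S) (le_cover R S) sup_inf_le ?_ ?_ sup_inf_le ?_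
  · rw [sup_comm R S]; exact cover_le S R
  · rw [sup_comm R S]; exact le_cover S R
  · refine le_antisymm (kernel_le R S) ?_
    rw [sup_comm R S]; exact kernel_le S R

theorem nonempty_quotient_mulEquiv_of_eq {K N K' N' : Subgroup G} [N.Normal] [N'.Normal]
    (hK : K = K') (hN : N = N') :
    Nonempty ((K ⧸ N.subgroupOf K) ≃* (K' ⧸ N'.subgroupOf K')) := by
  subst hK hN
  exact ⟨MulEquiv.refl _⟩

end Subgroup

theorem triple_symmetric_quotients_isomorphic
    (G : Type*) [Group G] (R S T : Subgroup G) [R.Normal] [S.Normal] [T.Normal] :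
    Nonempty
      (((((R ⊔ S) ⊓ (R ⊔ T) : Subgroup G)) ⧸ ((R ⊔ S ⊓ T).subgroupOf ((R ⊔ S) ⊓ (R ⊔ T)))) ≃*
       ((((S ⊔ R) ⊓ (S ⊔ T) : Subgroup G)) ⧸ ((S ⊔ R ⊓ T).subgroupOf ((S ⊔ R) ⊓ (S ⊔ T))))) ∧
    Nonempty
      (((((S ⊔ R) ⊓ (S ⊔ T) : Subgroup G)) ⧸ ((S ⊔ R ⊓ T).subgroupOf ((S ⊔ R) ⊓ (S ⊔ T)))) ≃*
       ((((T ⊔ R) ⊓ (T ⊔ S) : Subgroup G)) ⧸ ((T ⊔ R ⊓ S).subgroupOf ((T ⊔ R) ⊓ (T ⊔ S))))) := by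
  refine ⟨Subgroup.nonempty_sup_inf_sup_quotient_mulEquiv R S T, ?_⟩
  obtain ⟨e⟩ := Subgroup.nonempty_quotient_mulEquiv_of_eq
    (inf_comm (S ⊔ R) (S ⊔ T)) (congrArg (S ⊔ ·) (inf_comm R T))
  obtain ⟨f⟩ := Subgroup.nonempty_sup_inf_sup_quotient_mulEquiv S T R
  obtain ⟨g⟩ := Subgroup.nonempty_quotient_mulEquiv_of_eq
    (inf_comm (T ⊔ S) (T ⊔ R)) (congrArg (T ⊔ ·) (inf_comm S R))
  exact ⟨(e.trans f).trans g⟩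
end

section
/- For all integers n > 3 and k > 3, there exists a finitely generated group G such that π_n(S^k) is isomorphic as a group to the center Z(G) of G. -/
/-!
STATEMENT 15. For all integers `n > 3` and `k > 3` (i.e. `n = a + 4`,
`k = b + 4` with `a, b : ℕ`), there exists a finitely generated group `G` such
that `π_n(S^k)` is isomorphic as a group to the center `Z(G)` of `G`.
-/

/-- The `k`-sphere: the unit sphere in `ℝ^(k+1)`. -/
abbrev Sphere' (k : ℕ) : Type := Metric.sphere (0 : EuclideanSpace ℝ (Fin (k + 1))) 1

/-- A base point of the `k`-sphere. -/
noncomputable def sphereBasePt (k : ℕ) : Sphere' k :=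
  ⟨EuclideanSpace.single (0 : Fin (k + 1)) (1 : ℝ), by simp⟩

section CenterConstruction

open LaurentPolynomial

/-- The extension of the lamplighter group `ℤ ≀ ℤ` by `A` with cocycle
`(v, w) ↦ φ (invert v * w)` on lamp configurations. -/
@[ext]
structure TwistedLamplighter {A : Type} [AddCommGroup A] (φ : ℤ[T;T⁻¹] →+ A) where
  /-- The coordinate in the kernel `A`. -/
  fiber : A
  /-- The lamp configuration. -/
  lamp : ℤ[T;T⁻¹]
  /-- The position of the lamplighter. -/
  shift : ℤ

namespace TwistedLamplighter

variable {A : Type} [AddCommGroup A] (φ : ℤ[T;T⁻¹] →+ A)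

noncomputable instance : Mul (TwistedLamplighter φ) where
  mul x y := ⟨x.fiber + y.fiber + φ (invert x.lamp * T x.shift * y.lamp),
    x.lamp + T x.shift * y.lamp, x.shift + y.shift⟩

noncomputable instance : One (TwistedLamplighter φ) where
  one := ⟨0, 0, 0⟩

noncomputable instance : Inv (TwistedLamplighter φ) where
  inv x := ⟨-x.fiber + φ (invert x.lamp * x.lamp), -(T (-x.shift) * x.lamp), -x.shift⟩

variable {φ}

@[simp] lemma mul_fiber (x y : TwistedLamplighter φ) :
    (x * y).fiber = x.fiber + y.fiber + φ (invert x.lamp * T x.shift * y.lamp) := rfl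

@[simp] lemma mul_lamp (x y : TwistedLamplighter φ) :
    (x * y).lamp = x.lamp + T x.shift * y.lamp := rfl

@[simp] lemma mul_shift (x y : TwistedLamplighter φ) : (x * y).shift = x.shift + y.shift := rfl

@[simp] lemma one_fiber : (1 : TwistedLamplighter φ).fiber = 0 := rfl

@[simp] lemma one_lamp : (1 : TwistedLamplighter φ).lamp = 0 := rfl

@[simp] lemma one_shift : (1 : TwistedLamplighter φ).shift = 0 := rfl

@[simp] lemma inv_fiber (x : TwistedLamplighter φ) :
    x⁻¹.fiber = -x.fiber + φ (invert x.lamp * x.lamp) := rfl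

@[simp] lemma inv_lamp (x : TwistedLamplighter φ) : x⁻¹.lamp = -(T (-x.shift) * x.lamp) := rfl

@[simp] lemma inv_shift (x : TwistedLamplighter φ) : x⁻¹.shift = -x.shift := rfl

lemma T_neg_mul_T (n : ℤ) : (T (-n) * T n : ℤ[T;T⁻¹]) = 1 := by
  rw [← T_add, neg_add_cancel, T_zero]

noncomputable instance : Group (TwistedLamplighter φ) :=
  Group.ofLeftAxioms
    (fun x y z => by
      ext1
      · have h : invert (x.lamp + T x.shift * y.lamp) * T (x.shift + y.shift) * z.lamp =
            invert x.lamp * T x.shift * (T y.shift * z.lamp) +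
              invert y.lamp * T y.shift * z.lamp := by
          simp only [map_add, map_mul, invert_T, T_add]
          linear_combination (invert y.lamp * T y.shift * z.lamp) * T_neg_mul_T x.shift
        simp only [mul_fiber, mul_lamp, mul_shift, h]
        rw [mul_add, map_add, map_add]
        abel
      · simp only [mul_lamp, mul_shift, T_add]
        ring
      · simp [add_assoc])
    (fun x => by ext1 <;> simp)
    (fun x => by
      ext1
      · have h : invert (-(T (-x.shift) * x.lamp)) * T (-x.shift) * x.lamp =
            -(invert x.lamp * x.lamp) := by
          simp only [map_neg, map_mul, invert_T, neg_neg]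
          linear_combination -(invert x.lamp * x.lamp) * T_neg_mul_T x.shift
        simp only [mul_fiber, inv_lamp, inv_fiber, inv_shift, h, one_fiber]
        rw [map_neg]
        abel
      · simp
      · simp)

variable (φ) in
/-- The inclusion of the kernel `A`. -/
noncomputable def inFiber : Multiplicative A →* TwistedLamplighter φ where
  toFun a := ⟨a.toAdd, 0, 0⟩
  map_one' := rfl
  map_mul' a b := by ext1 <;> simp

lemma inFiber_injective : Function.Injective (inFiber φ) := fun _ _ h => congrArg fiber h

lemma inFiber_mem_center (a : Multiplicative A) :
    inFiber φ a ∈ Subgroup.center (TwistedLamplighter φ) := by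
  rw [Subgroup.mem_center_iff]
  intro g
  ext1 <;> simp [inFiber, add_comm]

lemma eq_zero_of_T_mul_eq {p : ℤ[T;T⁻¹]} {n : ℤ} (hn : n ≠ 0) (h : T n * p = p) : p = 0 := by
  have hT : (T n : ℤ[T;T⁻¹]) - 1 ≠ 0 := fun h0 => by
    have h1 := congrArg (fun q : ℤ[T;T⁻¹] => q.coeff n) (sub_eq_zero.1 h0)
    simp only [← T_zero (R := ℤ), T_apply, if_neg hn.symm] at h1
    simp at h1
  refine (mul_eq_zero.1 ?_).resolve_left hT
  rw [sub_mul, h, one_mul, sub_self]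

lemma exists_inFiber_of_mem_center {g : TwistedLamplighter φ}
    (hg : g ∈ Subgroup.center (TwistedLamplighter φ)) : ∃ a, inFiber φ a = g := by
  rw [Subgroup.mem_center_iff] at hg
  have hlamp : g.lamp = 0 := by
    apply eq_zero_of_T_mul_eq one_ne_zero
    simpa using congrArg lamp (hg ⟨0, 0, 1⟩)
  have hshift : g.shift = 0 := by
    have h := congrArg lamp (hg ⟨0, 1, 0⟩)
    simp only [mul_lamp, hlamp, mul_zero, add_zero, zero_add] at h
    by_contra hne
    exact one_ne_zero (eq_zero_of_T_mul_eq hne h.symm)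
  exact ⟨Multiplicative.ofAdd g.fiber, by ext1 <;> simp [inFiber, hlamp, hshift]⟩

variable (φ) in
/-- The kernel `A` is the whole center. -/
noncomputable def fiberEquivCenter : Multiplicative A ≃* Subgroup.center (TwistedLamplighter φ) :=
  MulEquiv.ofBijective ((inFiber φ).codRestrict _ inFiber_mem_center)
    ⟨fun _ _ h => inFiber_injective (congrArg Subtype.val h), fun g =>
      (exists_inFiber_of_mem_center g.2).imp fun _ h => Subtype.ext h⟩

lemma lamp_one_mul_lamp_T (m : ℤ) : (⟨0, 1, 0⟩ : TwistedLamplighter φ) * ⟨0, T m, 0⟩ =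
    inFiber φ (.ofAdd (φ (T m) - φ (T (-m)))) * (⟨0, T m, 0⟩ * ⟨0, 1, 0⟩) := by
  ext1 <;> simp [inFiber, add_comm]

lemma fg_of_surjective (hφ : ∀ a, ∃ m : ℤ, φ (T m) - φ (T (-m)) = a) :
    Group.FG (TwistedLamplighter φ) := by
  refine Group.fg_iff.2 ⟨{⟨0, 1, 0⟩, ⟨0, 0, 1⟩}, ?_, by simp⟩
  rw [eq_top_iff]
  set H := Subgroup.closure ({⟨0, 1, 0⟩, ⟨0, 0, 1⟩} : Set (TwistedLamplighter φ))
  have hlamp : (⟨0, 1, 0⟩ : TwistedLamplighter φ) ∈ H := Subgroup.subset_closure (by simp)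
  have hone : (⟨0, 0, 1⟩ : TwistedLamplighter φ) ∈ H := Subgroup.subset_closure (by simp)
  have hshift (n : ℤ) : (⟨0, 0, n⟩ : TwistedLamplighter φ) ∈ H := by
    have key : (⟨0, 0, n⟩ : TwistedLamplighter φ) = ⟨0, 0, 1⟩ ^ n := by
      induction n using Int.induction_on with
      | zero => rfl
      | succ k ih => rw [zpow_add_one, ← ih]; ext1 <;> simp
      | pred k ih => rw [zpow_sub_one, ← ih]; ext1 <;> simp [sub_eq_add_neg]
    rw [key]
    exact H.zpow_mem hone n
  have hT (n : ℤ) : (⟨0, T n, 0⟩ : TwistedLamplighter φ) ∈ H := by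
    have key : (⟨0, T n, 0⟩ : TwistedLamplighter φ) = ⟨0, 0, n⟩ * ⟨0, 1, 0⟩ * ⟨0, 0, -n⟩ := by
      ext1
      · simp only [mul_fiber, map_zero, mul_zero, zero_mul, add_zero]
      · simp only [mul_lamp, mul_zero, mul_one, add_zero, zero_add]
      · simp only [mul_shift, add_zero, add_neg_cancel]
    rw [key]; exact H.mul_mem (H.mul_mem (hshift n) hlamp) (hshift _)
  have hfiber (a : A) : inFiber φ (.ofAdd a) ∈ H := by
    obtain ⟨m, rfl⟩ := hφ a
    rw [eq_mul_inv_of_mul_eq (lamp_one_mul_lamp_T m).symm]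
    exact H.mul_mem (H.mul_mem hlamp (hT m)) (H.inv_mem (H.mul_mem (hT m) hlamp))
  have hall (v : ℤ[T;T⁻¹]) : ∃ a, (⟨a, v, 0⟩ : TwistedLamplighter φ) ∈ H := by
    have hadd {v w : ℤ[T;T⁻¹]} (hv : ∃ a, (⟨a, v, 0⟩ : TwistedLamplighter φ) ∈ H)
        (hw : ∃ a, (⟨a, w, 0⟩ : TwistedLamplighter φ) ∈ H) :
        ∃ a, (⟨a, v + w, 0⟩ : TwistedLamplighter φ) ∈ H := by
      obtain ⟨a, ha⟩ := hv
      obtain ⟨b, hb⟩ := hw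
      refine ⟨((⟨a, v, 0⟩ : TwistedLamplighter φ) * ⟨b, w, 0⟩).fiber, ?_⟩
      convert! H.mul_mem ha hb using 1
      ext1 <;> simp
    have hneg {v : ℤ[T;T⁻¹]} (hv : ∃ a, (⟨a, v, 0⟩ : TwistedLamplighter φ) ∈ H) :
        ∃ a, (⟨a, -v, 0⟩ : TwistedLamplighter φ) ∈ H := by
      obtain ⟨a, ha⟩ := hv
      refine ⟨((⟨a, v, 0⟩ : TwistedLamplighter φ)⁻¹).fiber, ?_⟩
      convert! H.inv_mem ha using 1
      ext1 <;> simp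
    induction v using LaurentPolynomial.induction_on' with
    | add p q hp hq => exact hadd hp hq
    | C_mul_T n k =>
      induction k using Int.induction_on with
      | zero => exact ⟨0, by simp only [map_zero, zero_mul]; exact H.one_mem⟩
      | succ k ih =>
        rw [map_add, map_one, add_mul, one_mul]
        exact hadd ih ⟨0, hT n⟩
      | pred k ih =>
        rw [map_sub, map_one, sub_mul, one_mul, sub_eq_add_neg]
        exact hadd ih (hneg ⟨0, hT n⟩)
  rintro ⟨a, v, n⟩ -
  obtain ⟨b, hb⟩ := hall v
  have key : (⟨a, v, n⟩ : TwistedLamplighter φ) =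
      inFiber φ (.ofAdd (a - b)) * ⟨b, v, 0⟩ * ⟨0, 0, n⟩ := by
    ext1 <;> simp [inFiber]
  rw [key]; exact H.mul_mem (H.mul_mem (hfiber _) hb) (hshift n)

end TwistedLamplighter

/-- Every countable abelian group is the center of a finitely generated group. -/
theorem exists_fg_group_center_mulEquiv (A : Type) [CommGroup A] [Countable A] :
    ∃ (G : Type) (_ : Group G), Group.FG G ∧ Nonempty (A ≃* Subgroup.center G) := by
  have : Countable (Additive A) := ‹Countable A›
  obtain ⟨f, hf⟩ := exists_surjective_nat (Additive A)
  let c : ℤ → Additive A := fun m => if 0 < m then f (m - 1).toNat else 0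
  let φ : ℤ[T;T⁻¹] →+ Additive A :=
    (Finsupp.liftAddHom fun m => zmultiplesHom (Additive A) (c m)).comp
      AddMonoidAlgebra.coeffAddEquiv.toAddMonoidHom
  have hφ (m : ℤ) : φ (T m) = c m := by
    change φ (AddMonoidAlgebra.single m 1) = c m
    simp [φ, - LaurentPolynomial.single_eq_C_mul_T]
  refine ⟨TwistedLamplighter φ, inferInstance, TwistedLamplighter.fg_of_surjective fun a => ?_,
    ⟨TwistedLamplighter.fiberEquivCenter φ⟩⟩
  obtain ⟨k, rfl⟩ := hf a
  refine ⟨k + 1, ?_⟩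
  have h₁ : (0 : ℤ) < k + 1 := by positivity
  have h₂ : ¬ (0 : ℤ) < -(k + 1) := by lia
  simp only [hφ, c, if_pos h₁, if_neg h₂]
  simp

end CenterConstruction

section Countability

variable {E : Type*} [NormedAddCommGroup E] [NormedSpace ℝ E]

/-- The straight-line homotopy between nearby maps into a unit sphere, pushed radially onto it. -/
theorem GenLoop.homotopic_of_dist_lt_one {N : Type*} {x : Metric.sphere (0 : E) 1}
    {f g : GenLoop N (Metric.sphere (0 : E) 1) x} (h : ∀ y, dist (f y) (g y) < 1) :
    GenLoop.Homotopic f g := by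
  let w : unitInterval × (N → unitInterval) → E :=
    fun p => (f p.2 : E) + (p.1 : ℝ) • ((g p.2 : E) - f p.2)
  have hf1 (y) : ‖(f y : E)‖ = 1 := norm_eq_of_mem_sphere _
  have hg1 (y) : ‖(g y : E)‖ = 1 := norm_eq_of_mem_sphere _
  have hfc : Continuous f := f.1.continuous
  have hgc : Continuous g := g.1.continuous
  have hwc : Continuous w := by fun_prop
  have hw (p) : w p ≠ 0 := by
    intro h0
    have h1 : (f p.2 : E) = (p.1 : ℝ) • ((f p.2 : E) - g p.2) := by
      have h0' : (f p.2 : E) + (p.1 : ℝ) • ((g p.2 : E) - f p.2) = 0 := h0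
      rw [← neg_sub (g p.2 : E), smul_neg]
      exact eq_neg_of_add_eq_zero_left h0'
    have h2 := congrArg norm h1
    have h3 := h p.2
    rw [Subtype.dist_eq, dist_eq_norm] at h3
    rw [norm_smul, hf1, Real.norm_of_nonneg p.1.2.1] at h2
    nlinarith [p.1.2.2, p.1.2.1, norm_nonneg ((f p.2 : E) - g p.2)]
  refine ⟨⟨⟨⟨fun p => ⟨‖w p‖⁻¹ • w p, ?_⟩, ?_⟩, fun y => ?_, fun y => ?_⟩, fun t y hy => ?_⟩⟩
  · simp [norm_smul, hw]
  · exact ((hwc.norm.inv₀ fun p => norm_ne_zero_iff.2 (hw p)).smul hwc).subtype_mk _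
  · ext1
    simp [w, hf1]
  · ext1
    simp [w, hg1]
  · ext1
    have hxy : g y = f y := (g.2 y hy).trans (f.2 y hy).symm
    simp [w, hf1, hxy]

instance HomotopyGroup.countable_sphere [FiniteDimensional ℝ E] {N : Type*} [Finite N]
    (x : Metric.sphere (0 : E) 1) :
    Countable (HomotopyGroup N (Metric.sphere (0 : E) 1) x) := by
  have := Fintype.ofFinite N
  have := FiniteDimensional.proper_real E
  obtain ⟨s, hs, hd⟩ :=
    TopologicalSpace.exists_countable_dense (GenLoop N (Metric.sphere (0 : E) 1) x)
  have := hs.to_subtype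
  refine Function.Surjective.countable (f := fun g : s =>
    (Quotient.mk _ g.1 : HomotopyGroup N (Metric.sphere (0 : E) 1) x)) fun q => ?_
  obtain ⟨f, rfl⟩ := Quotient.exists_rep q
  obtain ⟨g, hgs, hg⟩ := hd.exists_dist_lt f one_pos
  refine ⟨⟨g, hgs⟩, Quotient.sound (GenLoop.homotopic_of_dist_lt_one fun y => ?_)⟩
  rw [dist_comm]
  exact (ContinuousMap.dist_apply_le_dist y).trans_lt hg

end Countability

theorem homotopy_group_of_sphere_as_center (a b : ℕ) :
    ∃ (G : Type) (_ : Group G), Group.FG G ∧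
      Nonempty (HomotopyGroup.Pi (a + 4) (Sphere' (b + 4)) (sphereBasePt (b + 4)) ≃*
        Subgroup.center G) := by
  exact exists_fg_group_center_mulEquiv _
end
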